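/- arXiv:1903.03001 — 11 statements merged into one kernel-verified Lean document; each statement's English description precedes it below -/
import Mathlib

section
/- Let Σ be an alphabet and let % and $ be two distinct letters not in Σ. For every language L ⊆ Σ*, the inclusion {$w$ : w ∈ Σ*} ⊆ outf({%$u$ : u ∈ L}) holds if and only if L = Σ*. -/
/-- The set of all words over the set of letters `S` (i.e. `S*`). -/
def star {α : Type*} (S : Set α) : Set (List α) := {w | ∀ a ∈ w, a ∈ S}

/-- The outfix closure of a language. -/
def outf {α : Type*} (L : Set (List α)) : Set (List α) :=
  {z | ∃ x w y, z = x ++ y ∧ x ++ w ++ y ∈ L}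

/-- for `L ⊆ Σ*` and distinct `%`, `$` not in `Σ`,
`{$w$ : w ∈ Σ*} ⊆ outf({%$u$ : u ∈ L})` iff `L = Σ*`. -/
theorem stmt_3 {α : Type*} (S : Set α) (pc d : α) (hpc : pc ∉ S) (hd : d ∉ S)
    (hne : pc ≠ d) (L : Set (List α)) (hL : L ⊆ star S) :
    {w | ∃ u ∈ star S, w = [d] ++ u ++ [d]} ⊆
      outf {w | ∃ u ∈ L, w = [pc] ++ [d] ++ u ++ [d]} ↔ L = star S := by
  constructor
  · intro h
    refine hL.antisymm fun u hu => ?_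
    obtain ⟨x, w, y, hxy, v, hv, hw⟩ := h ⟨u, hu, rfl⟩
    have hdv : d ∉ v := fun hmem => hd (hL hv d hmem)
    cases x with
    | cons a x => simp_all
    | nil =>
      rw [List.nil_append] at hxy hw
      subst hxy
      rcases w with _ | ⟨a, _ | ⟨b, w⟩⟩
      · simp_all
      · simp_all
      · have hvw : w ++ d :: u = v := by
          apply List.append_cancel_right (bs := [d])
          simp_all
        simp [← hvw] at hdv
  · rintro rfl w ⟨u, hu, rfl⟩
    exact ⟨[], [pc], _, rfl, u, hu, by simp⟩
end

section
/- Let Σ be an alphabet, let % and $ be two distinct letters not in Σ, and set Σ_% = Σ ∪ {%}. Let (M_p)_{p≥1} be a family of languages with M_p ⊆ Σ* for every p ≥ 1, and let C ⊆ Σ_%* be a language containing every word of Σ_%* in which the letter % occurs at least once. Then the inclusion {$w$ : w ∈ Σ_%*} ⊆ inf( ⋃_{p≥1} %^p $ M_p $ ∪ $ C $ ) holds if and only if Σ* ⊆ (⋃_{p≥1} M_p) ∪ C. -/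
/-- The infix closure of a language. -/
def infx {α : Type*} (L : Set (List α)) : Set (List α) := {w | ∃ x y, x ++ w ++ y ∈ L}

/-- A word is split uniquely at the first occurrence of a letter `d`. -/
theorem append_cons_inj_of_notMem_prefix {α : Type*} {d : α} {x a s t : List α} (hx : d ∉ x)
    (ha : d ∉ a) (h : x ++ d :: s = a ++ d :: t) : x = a ∧ s = t := by
  induction x generalizing a with
  | nil => cases a <;> simp_all
  | cons b x ih => cases a <;> grind

/-- If `d` occurs in none of `a`, `m`, `u`, then the only infix of `a d m d` of the form `d u d`
is `d m d`. -/
theorem eq_of_delimited_infix {α : Type*} {d : α} {a m u x y : List α} (ha : d ∉ a) (hm : d ∉ m)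
    (hu : d ∉ u) (h : x ++ ([d] ++ u ++ [d]) ++ y = a ++ [d] ++ m ++ [d]) : u = m := by
  classical
  have hx : d ∉ x := by
    have hcount := congrArg (List.count d) h
    simp only [List.count_append, List.count_singleton_self, List.count_eq_zero_of_not_mem ha,
      List.count_eq_zero_of_not_mem hm, List.count_eq_zero_of_not_mem hu] at hcount
    exact List.count_eq_zero.mp (by omega)
  have h' : x ++ d :: (u ++ d :: y) = a ++ d :: (m ++ d :: []) := by simpa using h
  exact (append_cons_inj_of_notMem_prefix hu hm
    (append_cons_inj_of_notMem_prefix hx ha h').2).1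

/-- with `Σ_% = Σ ∪ {%}`, a family `M_p ⊆ Σ*` (p ≥ 1), and
`C ⊆ Σ_%*` containing every word of `Σ_%*` with an occurrence of `%`,
`{$w$ : w ∈ Σ_%*} ⊆ inf(⋃_{p≥1} %^p $ M_p $ ∪ $C$)` iff `Σ* ⊆ (⋃_{p≥1} M_p) ∪ C`. -/
theorem stmt_4 {α : Type*} (S : Set α) (pc d : α) (hpc : pc ∉ S) (hd : d ∉ S)
    (hne : pc ≠ d) (M : ℕ → Set (List α)) (hM : ∀ p, 1 ≤ p → M p ⊆ star S)
    (C : Set (List α)) (hC : C ⊆ star (S ∪ {pc}))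
    (hCfull : ∀ w ∈ star (S ∪ {pc}), pc ∈ w → w ∈ C) :
    {w | ∃ u ∈ star (S ∪ {pc}), w = [d] ++ u ++ [d]} ⊆
      infx ({w | ∃ p, 1 ≤ p ∧ ∃ m ∈ M p, w = List.replicate p pc ++ [d] ++ m ++ [d]} ∪
        {w | ∃ u ∈ C, w = [d] ++ u ++ [d]}) ↔
      star S ⊆ (⋃ p, ⋃ _ : 1 ≤ p, M p) ∪ C := by
  have hdS : ∀ w ∈ star S, d ∉ w := fun w hw h => hd (hw d h)
  have hdSp : ∀ w ∈ star (S ∪ {pc}), d ∉ w := fun w hw h =>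
    (hw d h).elim hd fun e => hne e.symm
  constructor
  · intro h w hw
    obtain ⟨x, y, hxy⟩ := h ⟨w, fun a ha => Or.inl (hw a ha), rfl⟩
    rcases hxy with ⟨p, hp, m, hm, e⟩ | ⟨c, hc, e⟩
    · have hdp : d ∉ List.replicate p pc := fun h => hne (List.eq_of_mem_replicate h).symm
      obtain rfl := eq_of_delimited_infix hdp (hdS m (hM p hp hm)) (hdS w hw) e
      exact Or.inl (Set.mem_iUnion₂.mpr ⟨p, hp, hm⟩)
    · obtain rfl := eq_of_delimited_infix (a := []) List.not_mem_nil (hdSp c (hC hc)) (hdS w hw) e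
      exact Or.inr hc
  · rintro h _ ⟨u, hu, rfl⟩
    have of_mem_C (huC : u ∈ C) : [d] ++ u ++ [d] ∈ infx
        ({w | ∃ p, 1 ≤ p ∧ ∃ m ∈ M p, w = List.replicate p pc ++ [d] ++ m ++ [d]} ∪
          {w | ∃ u ∈ C, w = [d] ++ u ++ [d]}) :=
      ⟨[], [], Or.inr ⟨u, huC, by simp⟩⟩
    by_cases hpu : pc ∈ u
    · exact of_mem_C (hCfull u hu hpu)
    · have huS : u ∈ star S := fun a ha =>
        (hu a ha).elim id fun e => absurd (e ▸ ha) hpu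
      rcases h huS with hu' | hu'
      · obtain ⟨p, hp, hm⟩ := Set.mem_iUnion₂.mp hu'
        exact ⟨List.replicate p pc, [], Or.inl ⟨p, hp, u, hm, by simp⟩⟩
      · exact of_mem_C hu'
end

section
/- Let Σ be an alphabet, let % and $ be two distinct letters not in Σ, and set Σ_% = Σ ∪ {%}. Let (M_p)_{p≥1} be a family of languages with M_p ⊆ Σ* for every p ≥ 1, and let C ⊆ Σ_%* be a language containing every word of Σ_%* in which the letter % occurs at least once. Then the inclusion {$w$ : w ∈ Σ_%*} ⊆ suff( ⋃_{p≥1} %^p $ M_p $ ∪ $ C $ ) holds if and only if Σ* ⊆ (⋃_{p≥1} M_p) ∪ C. -/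
/-- The suffix closure of a language. -/
def suff {α : Type*} (L : Set (List α)) : Set (List α) := {w | ∃ x, x ++ w ∈ L}

/-- with `Σ_% = Σ ∪ {%}`, a family `M_p ⊆ Σ*` (p ≥ 1), and
`C ⊆ Σ_%*` containing every word of `Σ_%*` with an occurrence of `%`,
`{$w$ : w ∈ Σ_%*} ⊆ suff(⋃_{p≥1} %^p $ M_p $ ∪ $C$)` iff `Σ* ⊆ (⋃_{p≥1} M_p) ∪ C`. -/
theorem stmt_5 {α : Type*} (S : Set α) (pc d : α) (hpc : pc ∉ S) (hd : d ∉ S)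
    (hne : pc ≠ d) (M : ℕ → Set (List α)) (hM : ∀ p, 1 ≤ p → M p ⊆ star S)
    (C : Set (List α)) (hC : C ⊆ star (S ∪ {pc}))
    (hCfull : ∀ w ∈ star (S ∪ {pc}), pc ∈ w → w ∈ C) :
    {w | ∃ u ∈ star (S ∪ {pc}), w = [d] ++ u ++ [d]} ⊆
      suff ({w | ∃ p, 1 ≤ p ∧ ∃ m ∈ M p, w = List.replicate p pc ++ [d] ++ m ++ [d]} ∪
        {w | ∃ u ∈ C, w = [d] ++ u ++ [d]}) ↔
      star S ⊆ (⋃ p, ⋃ _ : 1 ≤ p, M p) ∪ C := by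
  constructor
  · intro h w hw
    obtain ⟨x, ⟨p, hp, m, hm, hx⟩ | ⟨u, hu, hx⟩⟩ :=
      h ⟨w, fun a ha => Or.inl (hw a ha), rfl⟩
    · have hdm : d ∉ m := fun hmem => hd (hM p hp hm d hmem)
      have hdp : d ∉ List.replicate p pc := fun hmem => hne (List.eq_of_mem_replicate hmem).symm
      have key : List.replicate p pc ++ d :: m = x ++ d :: w := by
        apply List.append_cancel_right (bs := [d])
        simpa using hx.symm
      obtain ⟨-, -, rfl⟩ := (List.append_cons_inj_of_notMem hdp hdm).1 key
      exact Or.inl (Set.mem_iUnion₂.2 ⟨p, hp, hm⟩)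
    · have hdu : d ∉ u := fun hmem => (hC hu d hmem).elim hd fun h => hne h.symm
      have key : [] ++ d :: u = x ++ d :: w := by
        apply List.append_cancel_right (bs := [d])
        simpa using hx.symm
      obtain ⟨-, -, rfl⟩ := (List.append_cons_inj_of_notMem List.not_mem_nil hdu).1 key
      exact Or.inr hu
  · rintro h _ ⟨u, hu, rfl⟩
    by_cases hpu : pc ∈ u
    · exact ⟨[], Or.inr ⟨u, hCfull u hu hpu, rfl⟩⟩
    · have huS : u ∈ star S := fun a ha =>
        (hu a ha).elim id fun h => absurd (Set.mem_singleton_iff.1 h ▸ ha) hpu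
      rcases h huS with h | h
      · obtain ⟨p, hp, hm⟩ := Set.mem_iUnion₂.1 h
        exact ⟨List.replicate p pc, Or.inl ⟨p, hp, u, hm, by simp⟩⟩
      · exact ⟨[], Or.inr ⟨u, h, rfl⟩⟩
end

section
/- Let Σ be an alphabet and let T ⊆ Σ* be a language such that no word of T is a proper suffix of another word of T (i.e., if s, t ∈ T and s is a suffix of t, then s = t). Let N ⊆ T. Then suff( Σ*N ∪ (Σ* \ Σ*T) ) = Σ* if and only if T ⊆ N. -/
/-- if no word of `T` is a proper suffix of another word of `T`
and `N ⊆ T`, then `suff(Σ*N ∪ (Σ* \ Σ*T)) = Σ*` iff `T ⊆ N`.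
Here the alphabet `Σ` is the type `α` and `Σ* = univ`. -/
theorem stmt_6 {α : Type*} (T : Set (List α))
    (hT : ∀ s ∈ T, ∀ t ∈ T, s <:+ t → s = t)
    (N : Set (List α)) (hN : N ⊆ T) :
    suff ({w | ∃ u, ∃ n ∈ N, w = u ++ n} ∪ {w | ∃ u, ∃ t ∈ T, w = u ++ t}ᶜ) =
      Set.univ ↔ T ⊆ N := by
  constructor
  · intro h t ht
    obtain ⟨x, ⟨u, n, hn, hx⟩ | hx⟩ : t ∈ suff _ := h ▸ Set.mem_univ t
    · have hts : t <:+ x ++ t := List.suffix_append x t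
      have hns : n <:+ x ++ t := hx ▸ List.suffix_append u n
      obtain hs | hs := List.suffix_or_suffix_of_suffix hts hns
      · rwa [hT t ht n (hN hn) hs]
      · rwa [← hT n (hN hn) t ht hs]
    · exact absurd ⟨x, t, ht, rfl⟩ hx
  · intro h
    refine Set.eq_univ_of_forall fun w => ⟨[], ?_⟩
    by_cases hw : ∃ u, ∃ t ∈ T, w = u ++ t
    · obtain ⟨u, t, ht, hw⟩ := hw
      exact Or.inl ⟨u, t, h ht, hw⟩
    · exact Or.inr hw
end

section
/- Let Σ be an alphabet and let T ⊆ Σ* be a language such that no word of T is a proper prefix of another word of T (i.e., if s, t ∈ T and s is a prefix of t, then s = t). Let N ⊆ T. Then pref( NΣ* ∪ (Σ* \ TΣ*) ) = Σ* if and only if T ⊆ N. -/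
/-- The prefix closure of a language. -/
def pref {α : Type*} (L : Set (List α)) : Set (List α) := {w | ∃ x, w ++ x ∈ L}

/-- if no word of `T` is a proper prefix of another word of `T`
and `N ⊆ T`, then `pref(NΣ* ∪ (Σ* \ TΣ*)) = Σ*` iff `T ⊆ N`.
Here the alphabet `Σ` is the type `α` and `Σ* = univ`. -/
theorem stmt_7 {α : Type*} (T : Set (List α))
    (hT : ∀ s ∈ T, ∀ t ∈ T, s <+: t → s = t)
    (N : Set (List α)) (hN : N ⊆ T) :
    pref ({w | ∃ n ∈ N, ∃ u, w = n ++ u} ∪ {w | ∃ t ∈ T, ∃ u, w = t ++ u}ᶜ) =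
      Set.univ ↔ T ⊆ N := by
  constructor
  · intro h t ht
    have ht_pref : t ∈ pref _ := h.symm ▸ Set.mem_univ t
    obtain ⟨x, ⟨n, hn, u, hu⟩ | hx⟩ := ht_pref
    · have htn : t = n := by
        rcases List.prefix_or_prefix_of_prefix (List.prefix_append t x)
          (hu ▸ List.prefix_append n u) with hp | hp
        · exact hT t ht n (hN hn) hp
        · exact (hT n (hN hn) t ht hp).symm
      exact htn ▸ hn
    · exact absurd ⟨t, ht, x, rfl⟩ hx
  · intro h
    refine Set.eq_univ_of_forall fun w => ⟨[], ?_⟩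
    by_cases hw : ∃ t ∈ T, ∃ u, w ++ [] = t ++ u
    · obtain ⟨t, ht, u, hu⟩ := hw
      exact Or.inl ⟨t, h ht, u, hu⟩
    · exact Or.inr hw
end

section
/- Let Σ be an alphabet and let q, f be letters of Σ. Let T ⊆ Σ* be a language such that every word t ∈ T begins with the letter q, ends with the letter f, contains exactly one occurrence of q, and contains exactly one occurrence of f. Let N ⊆ T and let A = Σ* \ Σ*TΣ*. Then inf( A(NA)* ) = Σ* if and only if T ⊆ N. -/
open Computability

/-- A word that begins with `q`, ends with `f`, and contains each of these letters once. -/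
def IsDelimited {α : Type*} [DecidableEq α] (q f : α) (t : List α) : Prop :=
  t.head? = some q ∧ t.getLast? = some f ∧ t.count q = 1 ∧ t.count f = 1

namespace IsDelimited

variable {α : Type*} [DecidableEq α] {q f : α} {s t : List α}

lemma ne_nil (ht : IsDelimited q f t) : t ≠ [] := by
  rintro rfl
  simp [IsDelimited] at ht

/-- A delimited word cannot start strictly inside another delimited word. -/
lemma eq_nil_of_append (hs : IsDelimited q f s) (ht : IsDelimited q f t) {c d y r : List α}
    (hc : t = c ++ d) (hd : d ≠ []) (h : s ++ r = d ++ y) : c = [] := by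
  obtain ⟨d₀, d', rfl⟩ := List.exists_cons_of_ne_nil hd
  obtain ⟨s₀, s', rfl⟩ := List.exists_cons_of_ne_nil hs.ne_nil
  cases c with
  | nil => rfl
  | cons c₀ c' =>
    subst hc
    simp only [List.cons_append, List.cons.injEq] at h
    have h₁ := hs.1
    have h₂ := ht.1
    have h₃ := ht.2.2.1
    simp only [List.head?_cons, Option.some.injEq, List.cons_append] at h₁ h₂
    obtain ⟨rfl, -⟩ := h
    subst h₁ h₂
    simp [List.count_append] at h₃

lemma eq_of_eq_append (hs : IsDelimited q f s) (ht : IsDelimited q f t) {e : List α}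
    (h : t = s ++ e) : t = s := by
  rcases List.eq_nil_or_concat e with rfl | ⟨e', b, rfl⟩
  · simpa using h
  · have h₁ := ht.2.1
    have h₂ := ht.2.2.2
    have h₃ := hs.2.2.2
    subst h
    simp only [List.concat_eq_append, ← List.append_assoc, List.getLast?_append,
      List.getLast?_singleton, Option.some_or, Option.some.injEq] at h₁
    subst h₁
    simp [List.count_append, h₃] at h₂

lemma eq_of_append_eq_append (hs : IsDelimited q f s) (ht : IsDelimited q f t) {r y : List α}
    (h : s ++ r = t ++ y) : s = t := by
  rcases List.append_eq_append_iff.1 h with ⟨e, he, -⟩ | ⟨e, he, -⟩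
  · exact (hs.eq_of_eq_append ht he).symm
  · exact ht.eq_of_eq_append hs he

/-- An occurrence of `t` in `a ++ s ++ r` lies inside `a`, coincides with `s`, or lies
inside `r`. -/
lemma infix_append (hs : IsDelimited q f s) (ht : IsDelimited q f t) {a r : List α}
    (h : t <:+: a ++ (s ++ r)) : t <:+: a ∨ t = s ∨ t <:+: r := by
  obtain ⟨x, y, h⟩ := h
  rw [List.append_assoc] at h
  rcases List.append_eq_append_iff.1 h with ⟨c, hc, h'⟩ | ⟨c, -, h'⟩
  · rcases List.append_eq_append_iff.1 h' with ⟨d, rfl, -⟩ | ⟨d, hd, h''⟩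
    · exact .inl ⟨x, d, by simp [hc]⟩
    · by_cases hd₀ : d = []
      · exact .inl ⟨x, [], by simp_all⟩
      · obtain rfl := hs.eq_nil_of_append ht hd hd₀ h''
        exact .inr (.inl (ht.eq_of_append_eq_append hs h'))
  · rcases List.append_eq_append_iff.1 h' with ⟨d, -, h''⟩ | ⟨d, hd, h''⟩
    · exact .inr (.inr ⟨d, y, by simp [h'']⟩)
    · by_cases hd₀ : d = []
      · exact .inr (.inr ⟨[], y, by simp_all⟩)
      · obtain rfl := ht.eq_nil_of_append hs hd hd₀ h''
        exact .inr (.inl (ht.eq_of_append_eq_append hs h'.symm))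

end IsDelimited

namespace Language

variable {α : Type*}

lemma mem_compl_top_mul_mul_top {T : Language α} {w : List α} :
    w ∈ (⊤ * T * ⊤ : Language α)ᶜ ↔ ∀ t ∈ T, ¬ t <:+: w := by
  constructor
  · rintro h t ht ⟨x, y, rfl⟩
    exact h (append_mem_mul (append_mem_mul trivial ht) trivial)
  · rintro h hw
    obtain ⟨_, ⟨x, -, t, ht, rfl⟩, y, -, rfl⟩ := hw
    exact h t ht ⟨x, y, rfl⟩

/-- A delimited word without occurrences in the words of `A` that occurs in a word of `A(NA)*`
belongs to `N`. -/
lemma mem_of_infix_mem_mul_kstar [DecidableEq α] {q f : α} {N A : Language α} {t w : List α}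
    (hN : ∀ v ∈ N, IsDelimited q f v) (ht : IsDelimited q f t) (hA : ∀ a ∈ A, ¬ t <:+: a)
    (hw : w ∈ A * (N * A)∗) (h : t <:+: w) : t ∈ N := by
  obtain ⟨a, ha, _, ⟨L, rfl, hL⟩, rfl⟩ := hw
  induction L generalizing a with
  | nil => exact absurd (by simpa using h) (hA a ha)
  | cons b L ih =>
    obtain ⟨v, hv, a', ha', rfl⟩ := hL b (by simp)
    simp only [List.flatten_cons, List.append_assoc] at h
    rcases (hN v hv).infix_append ht h with h | rfl | h
    · exact absurd h (hA a ha)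
    · exact hv
    · exact ih a' ha' (fun y hy => hL y (List.mem_cons_of_mem _ hy)) h

/-- If no word of `T` is empty, every word factors into words of `T` separated by words
without infixes in `T`. -/
lemma mul_kstar_eq_top {T : Language α} (hT : [] ∉ T) :
    (⊤ * T * ⊤ : Language α)ᶜ * (T * (⊤ * T * ⊤ : Language α)ᶜ)∗ = ⊤ := by
  set A := (⊤ * T * ⊤ : Language α)ᶜ with hA
  rw [eq_top_iff]
  rintro w -
  induction hn : w.length using Nat.strong_induction_on generalizing w with
  | _ n ih =>
  by_cases hw : w ∈ A
  · exact ⟨w, hw, [], nil_mem_kstar _, by simp⟩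
  · rw [hA, mem_compl_top_mul_mul_top] at hw
    push Not at hw
    obtain ⟨t, ht, x, y, rfl⟩ := hw
    have ht₀ : 0 < t.length := List.length_pos_iff.2 fun h => hT (h ▸ ht)
    simp only [List.length_append] at hn
    have hx := ih x.length (by omega) rfl
    have hy := ih y.length (by omega) rfl
    have hle : A * (T * A)∗ * T * (A * (T * A)∗) ≤ A * (T * A)∗ :=
      calc A * (T * A)∗ * T * (A * (T * A)∗)
          = A * ((T * A)∗ * ((T * A) * (T * A)∗)) := by simp only [mul_assoc]
        _ ≤ A * ((T * A)∗ * (T * A)∗) := by gcongr; exact mul_kstar_le_kstar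
        _ = A * (T * A)∗ := by rw [kstar_mul_kstar]
    exact hle (append_mem_mul (append_mem_mul hx ht) hy)

end Language

/-- let every word of `T` begin with `q`, end with `f`, and
contain exactly one occurrence of each of `q` and `f`.  For `N ⊆ T` and
`A = Σ* \ Σ*TΣ*`, the infix closure of `A(NA)*` equals `Σ*` iff `T ⊆ N`.
The alphabet `Σ` is `α` and `Σ* = ⊤ = univ`. -/
theorem stmt_10 {α : Type*} [DecidableEq α] (q f : α) (T : Language α)
    (hT : ∀ t ∈ T, t.head? = some q ∧ t.getLast? = some f ∧
      t.count q = 1 ∧ t.count f = 1)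
    (N : Language α) (hN : N ≤ T)
    (A : Language α) (hA : A = ((⊤ : Language α) * T * (⊤ : Language α))ᶜ) :
    infx (A * (N * A)∗) = Set.univ ↔ T ≤ N := by
  subst hA
  constructor
  · intro h t ht
    obtain ⟨x, y, hxy⟩ : t ∈ infx _ := h ▸ Set.mem_univ t
    exact Language.mem_of_infix_mem_mul_kstar (fun v hv => hT v (hN hv)) (hT t ht)
      (fun a ha => Language.mem_compl_top_mul_mul_top.1 ha t ht) hxy ⟨x, y, rfl⟩
  · intro h
    obtain rfl := le_antisymm hN h
    rw [Language.mul_kstar_eq_top fun h => IsDelimited.ne_nil (hT [] h) rfl]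
    exact Set.eq_univ_of_forall fun w => ⟨[], [], trivial⟩
end

section
/- Let Σ be an alphabet, let % and $ be two distinct letters not in Σ, and set Σ_% = Σ ∪ {%}. For all languages L₁, L₂ ⊆ Σ*, the inclusion {$w$ : w ∈ Σ_%*} ⊆ inf( %$ (Σ* \ L₁) $ ∪ $ (Σ* \ L₂) $ ∪ $ Σ_%* % Σ_%* $ ) holds if and only if L₁ ∩ L₂ = ∅. -/
/-- A word with exactly two occurrences of the letter `d` determines the block between them. -/
theorem eq_of_append_delimited_eq {α : Type*} {d : α} {p q r u v : List α} (hr : d ∉ r)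
    (hu : d ∉ u) (hv : d ∉ v) (h : p ++ (d :: (u ++ [d])) ++ q = r ++ (d :: (v ++ [d]))) :
    u = v := by
  classical
  have hcount := congrArg (List.count d) h
  simp [List.count_eq_zero_of_not_mem hr, List.count_eq_zero_of_not_mem hu,
    List.count_eq_zero_of_not_mem hv] at hcount
  have hp : d ∉ p := List.count_eq_zero.1 (by omega)
  have split : ∀ {x₁ x₂ y₁ y₂ : List α}, d ∉ x₁ → d ∉ x₂ →
      x₁ ++ d :: y₁ = x₂ ++ d :: y₂ → x₁ = x₂ ∧ y₁ = y₂ := by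
    intro x₁
    induction x₁ with
    | nil => intro x₂ y₁ y₂ _ h₂ h; cases x₂ <;> simp_all
    | cons a x₁ ih => intro x₂ y₁ y₂ h₁ h₂ h; cases x₂ <;> grind
  have htail := (split (y₁ := u ++ d :: q) (y₂ := v ++ [d]) hp hr (by simpa using h)).2
  exact (split hu hv htail).1

/-- with `Σ_% = Σ ∪ {%}` and `L₁, L₂ ⊆ Σ*`,
`{$w$ : w ∈ Σ_%*} ⊆ inf( %$ (Σ*\L₁) $ ∪ $ (Σ*\L₂) $ ∪ $ Σ_%* % Σ_%* $ )`
iff `L₁ ∩ L₂ = ∅`. -/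
theorem stmt_11 {α : Type*} (S : Set α) (pc d : α) (hpc : pc ∉ S) (hd : d ∉ S)
    (hne : pc ≠ d) (L₁ L₂ : Set (List α)) (hL₁ : L₁ ⊆ star S) (hL₂ : L₂ ⊆ star S) :
    {w | ∃ u ∈ star (S ∪ {pc}), w = [d] ++ u ++ [d]} ⊆
      infx ({w | ∃ u ∈ star S \ L₁, w = [pc] ++ [d] ++ u ++ [d]} ∪
        {w | ∃ u ∈ star S \ L₂, w = [d] ++ u ++ [d]} ∪
        {w | ∃ x ∈ star (S ∪ {pc}), ∃ y ∈ star (S ∪ {pc}),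
          w = [d] ++ x ++ [pc] ++ y ++ [d]}) ↔
      L₁ ∩ L₂ = ∅ := by
  have notMem {u : List α} (hu : u ∈ star S) : d ∉ u := fun h => hd (hu d h)
  have notMem_pc {u : List α} (hu : u ∈ star (S ∪ {pc})) : d ∉ u := fun h =>
    (hu d h).elim hd fun h => hne h.symm
  constructor
  · intro hsub
    refine Set.eq_empty_iff_forall_notMem.2 fun u ⟨hu₁, hu₂⟩ => ?_
    have hu := hL₁ hu₁
    obtain ⟨p, q, (⟨v, ⟨hv, hvL⟩, h⟩ | ⟨v, ⟨hv, hvL⟩, h⟩) | ⟨x, hx, y, hy, h⟩⟩ :=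
      hsub ⟨u, fun a ha => Or.inl (hu a ha), rfl⟩
    · have huv : u = v := eq_of_append_delimited_eq (r := [pc]) (by simpa using hne.symm)
        (notMem hu) (notMem hv) (by simpa using h)
      exact hvL (huv ▸ hu₁)
    · have huv : u = v := eq_of_append_delimited_eq (r := []) List.not_mem_nil
        (notMem hu) (notMem hv) (by simpa using h)
      exact hvL (huv ▸ hu₂)
    · have huv : u = x ++ pc :: y := eq_of_append_delimited_eq (r := []) List.not_mem_nil
        (notMem hu) (by simp [notMem_pc hx, notMem_pc hy, hne.symm]) (by simpa using h)
      exact hpc (hu pc (by simp [huv]))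
  · rintro hdisj _ ⟨u, hu, rfl⟩
    by_cases hmem : pc ∈ u
    · obtain ⟨x, y, rfl⟩ := List.append_of_mem hmem
      exact ⟨[], [], Or.inr ⟨x, fun a ha => hu a (by simp [ha]), y,
        fun a ha => hu a (by simp [ha]), by simp⟩⟩
    · have huS : u ∈ star S := fun a ha =>
        (hu a ha).resolve_right fun h => hmem (Set.mem_singleton_iff.1 h ▸ ha)
      by_cases hu₁ : u ∈ L₁
      · have hu₂ : u ∉ L₂ := fun hu₂ => Set.eq_empty_iff_forall_notMem.1 hdisj u ⟨hu₁, hu₂⟩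
        exact ⟨[], [], Or.inl (Or.inr ⟨u, ⟨huS, hu₂⟩, by simp⟩)⟩
      · exact ⟨[pc], [], Or.inl (Or.inl ⟨u, ⟨huS, hu₁⟩, by simp⟩)⟩
end

section
/- Let Σ be an alphabet, let % and $ be two distinct letters not in Σ, and set Σ_% = Σ ∪ {%}. For all languages L₁, L₂ ⊆ Σ*, the inclusion {$w$ : w ∈ Σ_%*} ⊆ suff( %$ (Σ* \ L₁) $ ∪ $ (Σ* \ L₂) $ ∪ $ Σ_%* % Σ_%* $ ) holds if and only if L₁ ∩ L₂ = ∅. -/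
theorem eq_and_eq_of_append_cons_eq {α : Type*} {d : α} {p q u v : List α} (hu : d ∉ u)
    (hv : d ∉ v) (h : u ++ d :: p = v ++ d :: q) : u = v ∧ p = q := by
  induction u generalizing v with
  | nil => cases v <;> simp_all
  | cons a u ih =>
    cases v with
    | nil => exact absurd (List.cons.inj h).1.symm (List.ne_of_not_mem_cons hu)
    | cons b v =>
      simp only [List.cons_append, List.cons.injEq, List.mem_cons, not_or] at h hu hv ⊢
      exact ⟨⟨h.1, (ih hu.2 hv.2 h.2).1⟩, (ih hu.2 hv.2 h.2).2⟩

theorem eq_and_eq_of_append_delimited_eq {α : Type*} {d : α} {p q u v : List α} (hu : d ∉ u)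
    (hv : d ∉ v) (h : p ++ ([d] ++ u ++ [d]) = q ++ ([d] ++ v ++ [d])) : p = q ∧ u = v := by
  have h' : u.reverse ++ d :: p.reverse = v.reverse ++ d :: q.reverse := by
    simpa using congrArg List.reverse h
  simpa [and_comm] using
    eq_and_eq_of_append_cons_eq (by rwa [List.mem_reverse]) (by rwa [List.mem_reverse]) h'

/-- with `Σ_% = Σ ∪ {%}` and `L₁, L₂ ⊆ Σ*`,
`{$w$ : w ∈ Σ_%*} ⊆ suff( %$ (Σ*\L₁) $ ∪ $ (Σ*\L₂) $ ∪ $ Σ_%* % Σ_%* $ )`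
iff `L₁ ∩ L₂ = ∅`. -/
theorem stmt_12 {α : Type*} (S : Set α) (pc d : α) (hpc : pc ∉ S) (hd : d ∉ S)
    (hne : pc ≠ d) (L₁ L₂ : Set (List α)) (hL₁ : L₁ ⊆ star S) (hL₂ : L₂ ⊆ star S) :
    {w | ∃ u ∈ star (S ∪ {pc}), w = [d] ++ u ++ [d]} ⊆
      suff ({w | ∃ u ∈ star S \ L₁, w = [pc] ++ [d] ++ u ++ [d]} ∪
        {w | ∃ u ∈ star S \ L₂, w = [d] ++ u ++ [d]} ∪
        {w | ∃ x ∈ star (S ∪ {pc}), ∃ y ∈ star (S ∪ {pc}),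
          w = [d] ++ x ++ [pc] ++ y ++ [d]}) ↔
      L₁ ∩ L₂ = ∅ := by
  have hdS : ∀ u ∈ star S, d ∉ u := fun u hu h => hd (hu d h)
  have hdS' : ∀ u ∈ star (S ∪ {pc}), d ∉ u := fun u hu h =>
    (hu d h).elim hd fun h => hne h.symm
  constructor
  · intro h
    refine Set.eq_empty_iff_forall_notMem.2 fun u ⟨h₁, h₂⟩ => ?_
    have hu : u ∈ star S := hL₁ h₁
    obtain ⟨p, (⟨v, hv, e⟩ | ⟨v, hv, e⟩) | ⟨x, hx, y, hy, e⟩⟩ :=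
      h ⟨u, fun a ha => Or.inl (hu a ha), rfl⟩
    · have := eq_and_eq_of_append_delimited_eq (q := [pc]) (hdS u hu) (hdS v hv.1)
        (by simpa using e)
      exact hv.2 (this.2 ▸ h₁)
    · have := eq_and_eq_of_append_delimited_eq (q := []) (hdS u hu) (hdS v hv.1)
        (by simpa using e)
      exact hv.2 (this.2 ▸ h₂)
    · have := eq_and_eq_of_append_delimited_eq (q := []) (v := x ++ [pc] ++ y) (hdS u hu)
        (by simp [hdS' x hx, hdS' y hy, hne.symm]) (by simpa using e)
      exact hpc (hu pc (by simp [this.2]))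
  · rintro h _ ⟨u, hu, rfl⟩
    by_cases hmem : pc ∈ u
    · obtain ⟨x, y, rfl⟩ := List.append_of_mem hmem
      exact ⟨[], Or.inr ⟨x, fun a ha => hu a (by simp [ha]), y, fun a ha => hu a (by simp [ha]),
        by simp⟩⟩
    · have huS : u ∈ star S := fun a ha =>
        (hu a ha).resolve_right fun e => hmem (Set.mem_singleton_iff.1 e ▸ ha)
      by_cases h₁ : u ∈ L₁
      · have h₂ : u ∉ L₂ := fun h₂ => Set.eq_empty_iff_forall_notMem.1 h u ⟨h₁, h₂⟩
        exact ⟨[], Or.inl (Or.inr ⟨u, ⟨huS, h₂⟩, rfl⟩)⟩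
      · exact ⟨[pc], Or.inl (Or.inl ⟨u, ⟨huS, h₁⟩, by simp⟩)⟩
end

section
/- Let Σ be an alphabet, let % and $ be two distinct letters not in Σ, and set Σ_% = Σ ∪ {%}. For all languages L₁, L₂ ⊆ Σ*, the inclusion {$w$ : w ∈ Σ_%*} ⊆ outf( %%$ (Σ* \ L₁) $ ∪ %$ (Σ* \ L₂) $ ∪ %$ Σ_%* % Σ_%* $ ) holds if and only if L₁ ∩ L₂ = ∅. -/
/-- The last occurrence of a letter determines the part of the word after it. -/
theorem eq_of_append_cons_eq_append_cons {α : Type*} {d : α} {p q u v : List α}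
    (h : p ++ d :: u = q ++ d :: v) (hu : d ∉ u) (hv : d ∉ v) : u = v := by
  rcases List.append_eq_append_iff.1 h with ⟨r, -, h⟩ | ⟨r, -, h⟩ <;> cases r <;> simp_all

/-- If erasing a factor of `c p d v d` with `c ≠ d` leaves `d u d`, where `d` does not occur in
`u` and `v`, then `u = v`. -/
theorem eq_of_erase_factor {α : Type*} {c d : α} {p u v x w y : List α} (hne : c ≠ d)
    (hz : [d] ++ u ++ [d] = x ++ y) (h : x ++ w ++ y = c :: (p ++ d :: (v ++ [d])))
    (hu : d ∉ u) (hv : d ∉ v) : u = v := by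
  cases x with
  | cons a x => simp_all
  | nil =>
    simp only [List.nil_append] at hz h
    subst hz
    refine eq_of_append_cons_eq_append_cons (p := w) (q := c :: p) (d := d) ?_ hu hv
    apply List.append_cancel_right (bs := [d])
    simpa using h

theorem mem_outf_of_append_mem {α : Type*} {L : Set (List α)} {p z : List α} (h : p ++ z ∈ L) :
    z ∈ outf L :=
  ⟨[], p, z, rfl, h⟩

/-- with `Σ_% = Σ ∪ {%}` and `L₁, L₂ ⊆ Σ*`,
`{$w$ : w ∈ Σ_%*} ⊆ outf( %%$ (Σ*\L₁) $ ∪ %$ (Σ*\L₂) $ ∪ %$ Σ_%* % Σ_%* $ )`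
iff `L₁ ∩ L₂ = ∅`. -/
theorem stmt_13 {α : Type*} (S : Set α) (pc d : α) (hpc : pc ∉ S) (hd : d ∉ S)
    (hne : pc ≠ d) (L₁ L₂ : Set (List α)) (hL₁ : L₁ ⊆ star S) (hL₂ : L₂ ⊆ star S) :
    {w | ∃ u ∈ star (S ∪ {pc}), w = [d] ++ u ++ [d]} ⊆
      outf ({w | ∃ u ∈ star S \ L₁, w = [pc] ++ [pc] ++ [d] ++ u ++ [d]} ∪
        {w | ∃ u ∈ star S \ L₂, w = [pc] ++ [d] ++ u ++ [d]} ∪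
        {w | ∃ x ∈ star (S ∪ {pc}), ∃ y ∈ star (S ∪ {pc}),
          w = [pc] ++ [d] ++ x ++ [pc] ++ y ++ [d]}) ↔
      L₁ ∩ L₂ = ∅ := by
  have d_notMem : ∀ u ∈ star (S ∪ {pc}), d ∉ u := fun u hu h =>
    (hu d h).elim hd fun h => hne h.symm
  have star_mono : star S ⊆ star (S ∪ {pc}) := fun u hu a ha => Or.inl (hu a ha)
  constructor
  · intro h
    refine Set.eq_empty_iff_forall_notMem.2 fun u ⟨hu₁, hu₂⟩ => ?_
    have hu := hL₁ hu₁
    have hdu := d_notMem u (star_mono hu)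
    obtain ⟨x, w, y, hz, hm⟩ := h ⟨u, star_mono hu, rfl⟩
    rcases hm with (⟨v, ⟨hv, hv₁⟩, hw⟩ | ⟨v, ⟨hv, hv₂⟩, hw⟩) | ⟨v, hv, t, ht, hw⟩
    · have := eq_of_erase_factor (p := [pc]) hne hz (by simpa using hw) hdu
        (d_notMem v (star_mono hv))
      exact hv₁ (this ▸ hu₁)
    · have := eq_of_erase_factor (p := []) hne hz (by simpa using hw) hdu
        (d_notMem v (star_mono hv))
      exact hv₂ (this ▸ hu₂)
    · have : u = v ++ pc :: t := eq_of_erase_factor (p := []) hne hz (by simpa using hw) hdu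
        (by simp [d_notMem v hv, d_notMem t ht, hne.symm])
      exact hpc (hu pc (by simp [this]))
  · rintro h _ ⟨u, hu, rfl⟩
    by_cases hpu : pc ∈ u
    · obtain ⟨x, y, rfl⟩ := List.append_of_mem hpu
      exact mem_outf_of_append_mem (p := [pc]) <| Or.inr
        ⟨x, fun a ha => hu a (by simp [ha]), y, fun a ha => hu a (by simp [ha]), by simp⟩
    · have huS : u ∈ star S := fun a ha =>
        (hu a ha).resolve_right fun hap => hpu (Set.mem_singleton_iff.1 hap ▸ ha)
      by_cases hu₁ : u ∈ L₁
      · have hu₂ : u ∉ L₂ := fun hu₂ => Set.eq_empty_iff_forall_notMem.1 h u ⟨hu₁, hu₂⟩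
        exact mem_outf_of_append_mem (p := [pc]) <| Or.inl <| Or.inr ⟨u, ⟨huS, hu₂⟩, by simp⟩
      · exact mem_outf_of_append_mem (p := [pc, pc]) <| Or.inl <| Or.inl
          ⟨u, ⟨huS, hu₁⟩, by simp⟩
end

section
/- Let Σ be an alphabet, let w₁, …, w_k be nonempty words over Σ, and let L ⊆ w₁*⋯w_k* be any language contained in this bounded set. Then each of pref(L), suff(L), inf(L) and outf(L) is a bounded language; that is, for each ρ ∈ {pref, suff, inf, outf} there exist l ≥ 1 and words v₁, …, v_l over Σ such that ρ(L) ⊆ v₁*⋯v_l*. -/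
/-- The bounded language `v₁* ⋯ v_l*` determined by the words `v 0, …, v (l-1)`. -/
def boundedBy {α : Type*} (l : ℕ) (v : Fin l → List α) : Set (List α) :=
  {x | ∃ e : Fin l → ℕ, x = (List.ofFn fun i => (List.replicate (e i) (v i)).flatten).flatten}

/-- The language `v₁* ⋯ v_l*` of a list of words `[v₁, …, v_l]`. -/
def starProd {α : Type*} : List (List α) → Set (List α)
  | [] => {[]}
  | v :: vs => {x | ∃ n, ∃ y ∈ starProd vs, x = (List.replicate n v).flatten ++ y}

theorem boundedBy_eq_starProd {α : Type*} (l : ℕ) (v : Fin l → List α) :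
    boundedBy l v = starProd (List.ofFn v) := by
  induction l with
  | zero => ext x; simp [boundedBy, starProd]
  | succ l ih =>
    ext x
    rw [List.ofFn_succ]
    simp only [starProd, ← ih, boundedBy, Set.mem_ofPred_eq, List.ofFn_succ, List.flatten_cons]
    constructor
    · rintro ⟨e, rfl⟩
      exact ⟨e 0, _, ⟨fun i => e i.succ, rfl⟩, rfl⟩
    · rintro ⟨n, _, ⟨e, rfl⟩, rfl⟩
      exact ⟨Fin.cons n e, by simp⟩

theorem exists_boundedBy_of_subset_starProd {α : Type*} {L : Set (List α)} {ws : List (List α)}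
    (h : L ⊆ starProd ws) : ∃ l, 1 ≤ l ∧ ∃ v : Fin l → List α, L ⊆ boundedBy l v := by
  refine ⟨([] :: ws).length, by simp, ([] :: ws).get, fun x hx => ?_⟩
  rw [boundedBy_eq_starProd, List.ofFn_get]
  exact ⟨0, x, h hx, by simp⟩

theorem nil_mem_starProd {α : Type*} (ws : List (List α)) : [] ∈ starProd ws := by
  induction ws with
  | nil => rfl
  | cons v vs ih => exact ⟨0, [], ih, by simp⟩

theorem append_mem_starProd {α : Type*} {vs ws : List (List α)} {x y : List α}
    (hx : x ∈ starProd vs) (hy : y ∈ starProd ws) : x ++ y ∈ starProd (vs ++ ws) := by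
  induction vs generalizing x with
  | nil => obtain rfl : x = [] := hx; exact hy
  | cons v vs ih =>
    obtain ⟨n, z, hz, rfl⟩ := hx
    exact ⟨n, z ++ y, ih hz, by simp⟩

theorem replicate_flatten_mem_starProd {α : Type*} (v : List α) (n : ℕ) :
    (List.replicate n v).flatten ∈ starProd [v] :=
  ⟨n, [], rfl, by simp⟩

theorem mem_starProd_of_mem {α : Type*} {ws : List (List α)} {x : List α} (h : x ∈ ws) :
    x ∈ starProd ws := by
  induction ws with
  | nil => simp at h
  | cons v vs ih =>
    rcases List.mem_cons.1 h with rfl | h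
    · exact ⟨1, [], nil_mem_starProd vs, by simp⟩
    · exact ⟨0, x, ih h, by simp⟩

theorem mem_starProd_of_isPrefix_replicate_flatten {α : Type*} {v x : List α} {n : ℕ}
    (h : x <+: (List.replicate n v).flatten) : x ∈ starProd (v :: v.inits) := by
  induction n generalizing x with
  | zero =>
    obtain rfl : x = [] := by simpa using h
    exact nil_mem_starProd _
  | succ n ih =>
    obtain ⟨y, hy⟩ := h
    rw [List.replicate_succ, List.flatten_cons, List.append_eq_append_iff] at hy
    rcases hy with ⟨a, rfl, -⟩ | ⟨a, rfl, ha⟩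
    · exact ⟨0, x, mem_starProd_of_mem (by simp), by simp⟩
    · obtain ⟨m, z, hz, rfl⟩ := ih ⟨y, ha.symm⟩
      exact ⟨m + 1, z, hz, by simp [List.replicate_succ]⟩

theorem mem_starProd_of_isSuffix_replicate_flatten {α : Type*} {v x : List α} {n : ℕ}
    (h : x <:+ (List.replicate n v).flatten) : x ∈ starProd (v.tails ++ [v]) := by
  induction n with
  | zero =>
    obtain rfl : x = [] := by simpa using h
    exact nil_mem_starProd _
  | succ n ih =>
    obtain ⟨y, hy⟩ := h
    rw [List.replicate_succ, List.flatten_cons, List.append_eq_append_iff] at hy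
    rcases hy with ⟨a, rfl, rfl⟩ | ⟨a, rfl, ha⟩
    · exact append_mem_starProd (mem_starProd_of_mem (by simp))
        (replicate_flatten_mem_starProd _ n)
    · exact ih ⟨a, ha.symm⟩

theorem exists_pref_subset_starProd {α : Type*} (ws : List (List α)) :
    ∃ vs, pref (starProd ws) ⊆ starProd vs := by
  induction ws with
  | nil =>
    refine ⟨[], ?_⟩
    rintro x ⟨y, hy⟩
    exact (List.append_eq_nil_iff.1 hy).1
  | cons v ws ih =>
    obtain ⟨vs, hvs⟩ := ih
    refine ⟨v :: v.inits ++ vs, ?_⟩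
    rintro x ⟨y, n, z, hz, h⟩
    rcases List.append_eq_append_iff.1 h with ⟨a, ha, -⟩ | ⟨a, rfl, rfl⟩
    · simpa using append_mem_starProd
        (mem_starProd_of_isPrefix_replicate_flatten ⟨a, ha.symm⟩) (nil_mem_starProd vs)
    · exact append_mem_starProd
        (mem_starProd_of_isPrefix_replicate_flatten List.prefix_rfl) (hvs ⟨y, hz⟩)

theorem exists_suff_subset_starProd {α : Type*} (ws : List (List α)) :
    ∃ vs, suff (starProd ws) ⊆ starProd vs := by
  induction ws with
  | nil =>
    refine ⟨[], ?_⟩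
    rintro x ⟨y, hy⟩
    exact (List.append_eq_nil_iff.1 hy).2
  | cons v ws ih =>
    obtain ⟨vs, hvs⟩ := ih
    refine ⟨v.tails ++ [v] ++ ws ++ vs, ?_⟩
    rintro x ⟨y, n, z, hz, h⟩
    rcases List.append_eq_append_iff.1 h with ⟨a, ha, rfl⟩ | ⟨a, rfl, rfl⟩
    · simpa using append_mem_starProd (append_mem_starProd
        (mem_starProd_of_isSuffix_replicate_flatten ⟨y, ha.symm⟩) hz) (nil_mem_starProd vs)
    · exact append_mem_starProd (nil_mem_starProd (v.tails ++ [v] ++ ws)) (hvs ⟨a, hz⟩)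

/-- if `L ⊆ w₁*⋯w_k*` with the `wᵢ` nonempty, then each of
`pref L`, `suff L`, `inf L`, `outf L` is bounded, i.e. contained in some
`v₁*⋯v_l*` with `l ≥ 1`. -/
theorem stmt_14 {α : Type*} (k : ℕ) (hk : 1 ≤ k) (w : Fin k → List α)
    (hw : ∀ i, w i ≠ []) (L : Set (List α)) (hL : L ⊆ boundedBy k w) :
    (∃ l, 1 ≤ l ∧ ∃ v : Fin l → List α, pref L ⊆ boundedBy l v) ∧
    (∃ l, 1 ≤ l ∧ ∃ v : Fin l → List α, suff L ⊆ boundedBy l v) ∧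
    (∃ l, 1 ≤ l ∧ ∃ v : Fin l → List α, infx L ⊆ boundedBy l v) ∧
    (∃ l, 1 ≤ l ∧ ∃ v : Fin l → List α, outf L ⊆ boundedBy l v) := by
  rw [boundedBy_eq_starProd] at hL
  obtain ⟨ps, hps⟩ := exists_pref_subset_starProd (List.ofFn w)
  obtain ⟨ss, hss⟩ := exists_suff_subset_starProd (List.ofFn w)
  obtain ⟨is, his⟩ := exists_suff_subset_starProd ps
  refine ⟨exists_boundedBy_of_subset_starProd (ws := ps) ?_,
    exists_boundedBy_of_subset_starProd (ws := ss) ?_,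
    exists_boundedBy_of_subset_starProd (ws := is) ?_,
    exists_boundedBy_of_subset_starProd (ws := ps ++ ss) ?_⟩
  · rintro x ⟨y, h⟩
    exact hps ⟨y, hL h⟩
  · rintro x ⟨y, h⟩
    exact hss ⟨y, hL h⟩
  · rintro x ⟨y, z, h⟩
    exact his ⟨y, hps ⟨z, hL h⟩⟩
  · rintro _ ⟨x, u, y, rfl, h⟩
    exact append_mem_starProd (hps ⟨u ++ y, by simpa using hL h⟩) (hss ⟨x ++ u, hL h⟩)
end

section
/- The Permuted Post Correspondence Problem is decidable: the predicate that holds of a pair (X, Y) of equal-length lists X = (x₁, …, x_n), Y = (y₁, …, y_n) of nonempty words over the alphabet {0,1} exactly when there exist k ≥ 1 and index sequences I = (i₁, …, i_k) and J = (j₁, …, j_k), with all entries in {1, …, n}, such that I is a permutation of J (as finite sequences, i.e., J is a rearrangement of I) and x_{i₁}⋯x_{i_k} = y_{j₁}⋯y_{j_k}, is a computable predicate (in the sense of computability theory, with pairs of lists of words encoded as natural numbers in a standard way). -/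
theorem exists_perm_partial_sums_abs_le (M : ℕ) (s : Multiset ℤ) (p : ℤ) (hp : |p| ≤ M)
    (hs : ∀ a ∈ s, |a| ≤ M) (h0 : p + s.sum = 0) :
    ∃ l : List ℤ, (l : Multiset ℤ) = s ∧ ∀ k, |p + (l.take k).sum| ≤ M := by
  induction hc : s.card generalizing s p with
  | zero =>
    obtain rfl := Multiset.card_eq_zero.1 hc
    exact ⟨[], rfl, by simpa using hp⟩
  | succ m ih =>
    obtain ⟨a, ha, hpa⟩ : ∃ a ∈ s, |p + a| ≤ M := by
      by_contra! hcon
      rcases lt_or_ge 0 p with h | h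
      · have : 0 ≤ s.sum := Multiset.sum_nonneg fun a ha => by
          have h1 := hcon a ha
          have h2 := hs a ha
          by_contra! h3
          rw [abs_le] at *
          have : |p + a| ≤ M := by rw [abs_le]; constructor <;> omega
          omega
        omega
      · obtain ⟨b, hb⟩ := Multiset.card_pos_iff_exists_mem.1 (by omega : 0 < s.card)
        obtain ⟨s', rfl⟩ := Multiset.exists_cons_of_mem hb
        have key : ∀ a ∈ b ::ₘ s', a ≤ -1 := fun a ha => by
          have h1 := hcon a ha
          have h2 := hs a ha
          by_contra! h3
          rw [abs_le] at *
          have : |p + a| ≤ M := by rw [abs_le]; constructor <;> omega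
          omega
        have h1 := key b (by simp)
        have h2 := Multiset.sum_le_card_nsmul s' (-1) fun a ha => key a (by simp [ha])
        rw [nsmul_eq_mul] at h2
        rw [Multiset.sum_cons] at h0
        omega
    obtain ⟨s', rfl⟩ := Multiset.exists_cons_of_mem ha
    obtain ⟨l, rfl, hl⟩ := ih s' (p + a) hpa (fun b hb => hs b (by simp [hb]))
      (by rw [Multiset.sum_cons] at h0; omega) (by simpa using hc)
    refine ⟨a :: l, rfl, fun k => ?_⟩
    cases k with
    | zero => simpa using hp
    | succ k => simpa [add_assoc] using hl k

theorem exists_short_zero_sum_int (M : ℕ) (s : Multiset ℤ) (hne : s ≠ 0)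
    (hs : ∀ a ∈ s, |a| ≤ M) (h0 : s.sum = 0) :
    ∃ t ≤ s, t ≠ 0 ∧ t.sum = 0 ∧ t.card ≤ 2 * M + 1 := by
  obtain ⟨l, rfl, hl⟩ := exists_perm_partial_sums_abs_le M s 0 (by simp) hs (by simpa using h0)
  simp only [zero_add] at hl
  by_cases hlen : l.length ≤ 2 * M + 1
  · exact ⟨l, le_rfl, hne, h0, by simpa using hlen⟩
  obtain ⟨i, hi, j, hj, hij, he⟩ := Finset.exists_ne_map_eq_of_card_lt_of_maps_to
    (s := Finset.range (2 * M + 2)) (t := Finset.Icc (-M : ℤ) M) (f := fun k => (l.take k).sum)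
    (by simp only [Int.card_Icc, Finset.card_range]; omega)
    (fun k _ => by simpa [abs_le] using hl k)
  wlog hlt : i < j generalizing i j
  · exact this j hj i hi hij.symm he.symm (by omega)
  simp only [Finset.mem_range] at hi hj
  refine ⟨((l.take j).drop i : List ℤ), ?_, ?_, ?_, ?_⟩
  · exact ((List.drop_sublist _ _).trans (List.take_sublist _ _)).subperm
  · rw [← Multiset.card_pos]
    simp only [Multiset.coe_card, List.length_drop, List.length_take]
    omega
  · have h1 : (l.take j).take i = l.take i := by rw [List.take_take]; congr 1; omega
    have := List.sum_take_add_sum_drop (l.take j) i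
    rw [h1] at this
    rw [Multiset.sum_coe]
    omega
  · simp only [Multiset.coe_card, List.length_drop, List.length_take]
    omega

theorem Multiset.exists_le_map_eq {α β : Type*} (f : α → β) (s : Multiset α) (t : Multiset β)
    (h : t ≤ s.map f) : ∃ t' ≤ s, t'.map f = t := by
  classical
  induction s using Multiset.induction generalizing t with
  | empty => exact ⟨0, le_rfl, (Multiset.le_zero.1 (by simpa using h)).symm⟩
  | cons a s ih =>
    rw [Multiset.map_cons] at h
    by_cases ha : f a ∈ t
    · obtain ⟨t, rfl⟩ := Multiset.exists_cons_of_mem ha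
      obtain ⟨t', h1, rfl⟩ := ih t (by simpa using h)
      exact ⟨a ::ₘ t', by simpa using h1, by simp⟩
    · obtain ⟨t', h1, rfl⟩ := ih t ((Multiset.le_cons_of_notMem ha).1 h)
      exact ⟨t', h1.trans (Multiset.le_cons_self _ _), rfl⟩

theorem exists_zero_sum_blocks {α : Type*} (g : α → ℤ) (M : ℕ) (s : Multiset α)
    (hs : ∀ a ∈ s, |g a| ≤ M) (h0 : (s.map g).sum = 0) :
    ∃ B : Multiset (Multiset α), B.join = s ∧
      ∀ b ∈ B, b ≠ 0 ∧ (b.map g).sum = 0 ∧ b.card ≤ 2 * M + 1 := by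
  classical
  induction hc : s.card using Nat.strong_induction_on generalizing s with
  | _ m ih =>
    by_cases hne : s = 0
    · exact ⟨0, by simp [hne], by simp⟩
    obtain ⟨t, ht, htne, ht0, htc⟩ := exists_short_zero_sum_int M (s.map g) (by simpa using hne)
      (by simpa using hs) h0
    obtain ⟨b, hb, rfl⟩ := Multiset.exists_le_map_eq g s t ht
    obtain ⟨r, rfl⟩ := Multiset.le_iff_exists_add.1 hb
    rw [Multiset.map_add, Multiset.sum_add, ht0, zero_add] at h0
    have hbne : b ≠ 0 := by simpa using htne
    have := Multiset.card_pos.2 hbne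
    obtain ⟨B, hB, hB'⟩ := ih r.card (by rw [← hc, Multiset.card_add]; omega) r
      (fun a ha => hs a (by simp [ha])) h0 rfl
    refine ⟨b ::ₘ B, by simp [hB], fun c hcB => ?_⟩
    rcases Multiset.mem_cons.1 hcB with rfl | h
    · exact ⟨hbne, ht0, by simpa using htc⟩
    · exact hB' c h

theorem Multiset.abs_sum_map_le {α : Type*} (g : α → ℤ) (M : ℕ) (s : Multiset α)
    (hs : ∀ a ∈ s, |g a| ≤ M) : |(s.map g).sum| ≤ s.card * M := by
  induction s using Multiset.induction with
  | empty => simp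
  | cons a s ih =>
    have h1 := hs a (by simp)
    have h2 := ih fun b hb => hs b (by simp [hb])
    simp only [Multiset.map_cons, Multiset.sum_cons, Multiset.card_cons]
    push_cast
    have := abs_add_le (g a) (s.map g).sum
    linarith

theorem Multiset.sum_map_join {α : Type*} (g : α → ℤ) (B : Multiset (Multiset α)) :
    (B.join.map g).sum = (B.map fun b => (b.map g).sum).sum := by
  induction B using Multiset.induction with
  | empty => simp
  | cons a s ih => simp

theorem exists_short_zero_sum (n : ℕ) {α : Type*} (f : α → ℕ → ℤ) (M : ℕ) (s : Multiset α)
    (hne : s ≠ 0) (hs : ∀ a ∈ s, ∀ i < n, |f a i| ≤ M)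
    (h0 : ∀ i < n, (s.map fun a => f a i).sum = 0) :
    ∃ t ≤ s, t ≠ 0 ∧ (∀ i < n, (t.map fun a => f a i).sum = 0) ∧
      t.card ≤ (2 * M + 1) ^ 3 ^ n := by
  induction n generalizing α M with
  | zero =>
    obtain ⟨a, ha⟩ := Multiset.exists_mem_of_ne_zero hne
    exact ⟨{a}, by simpa using ha, by simp, by simp, by simp⟩
  | succ n ih =>
    obtain ⟨B, rfl, hB⟩ := exists_zero_sum_blocks (fun a => f a n) M s
      (fun a ha => hs a ha n (by omega)) (h0 n (by omega))
    obtain ⟨T, hT, hTne, hT0, hTc⟩ := ih (fun b i => (b.map fun a => f a i).sum)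
      ((2 * M + 1) * M) B (by rintro rfl; simp at hne)
      (fun b hb i hi => by
        refine (Multiset.abs_sum_map_le _ M b fun a ha =>
          hs a (Multiset.mem_join.2 ⟨b, hb, ha⟩) i (by omega)).trans ?_
        have := (hB b hb).2.2
        exact_mod_cast Nat.mul_le_mul_right M this)
      (fun i hi => by rw [← Multiset.sum_map_join]; exact h0 i (by omega))
    obtain ⟨R, rfl⟩ := Multiset.le_iff_exists_add.1 hT
    refine ⟨T.join, by simp, ?_, fun i hi => ?_, ?_⟩
    · obtain ⟨b, hb⟩ := Multiset.exists_mem_of_ne_zero hTne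
      obtain ⟨a, ha⟩ := Multiset.exists_mem_of_ne_zero (hB b (by simp [hb])).1
      exact fun h => Multiset.notMem_zero a (h ▸ Multiset.mem_join.2 ⟨b, hb, ha⟩)
    · rw [Multiset.sum_map_join]
      rcases Nat.lt_succ_iff_lt_or_eq.1 hi with h | rfl
      · exact hT0 i h
      · refine Multiset.sum_eq_zero fun x hx => ?_
        obtain ⟨b, hb, rfl⟩ := Multiset.mem_map.1 hx
        exact (hB b (by simp [hb])).2.1
    · have h1 : T.join.card ≤ T.card * (2 * M + 1) := by
        rw [Multiset.card_join]
        refine (Multiset.sum_le_card_nsmul _ (2 * M + 1) fun x hx => ?_).trans (by simp)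
        obtain ⟨b, hb, rfl⟩ := Multiset.mem_map.1 hx
        exact (hB b (by simp [hb])).2.2
      calc T.join.card ≤ T.card * (2 * M + 1) := h1
        _ ≤ (2 * ((2 * M + 1) * M) + 1) ^ 3 ^ n * (2 * M + 1) := Nat.mul_le_mul_right _ hTc
        _ ≤ ((2 * M + 1) ^ 2) ^ 3 ^ n * (2 * M + 1) ^ 3 ^ n := by
          refine Nat.mul_le_mul (Nat.pow_le_pow_left (by nlinarith) _) ?_
          exact Nat.le_self_pow (by positivity) _
        _ = (2 * M + 1) ^ 3 ^ (n + 1) := by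
          rw [← pow_mul, ← pow_add, pow_succ]; congr 1; ring

theorem exists_small_submultiset_sum_eq (n : ℕ) {α : Type*} (f : α → ℕ → ℤ) (M : ℕ)
    (c : Multiset α) (hc : ∀ a ∈ c, ∀ i < n, |f a i| ≤ M)
    (hsum : ∀ i < n, |(c.map fun a => f a i).sum| ≤ M) :
    ∃ t ≤ c, (∀ i < n, (t.map fun a => f a i).sum = (c.map fun a => f a i).sum) ∧
      t.card ≤ (2 * M + 1) ^ 3 ^ n := by
  classical
  induction hm : c.card using Nat.strong_induction_on generalizing c with
  | _ m ih =>
    set σ : ℕ → ℤ := fun i => -(c.map fun a => f a i).sum with hσ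
    obtain ⟨t, ht, htne, ht0, htc⟩ := exists_short_zero_sum n (fun v : ℕ → ℤ => v) M
      (σ ::ₘ c.map f) (by simp)
      (by
        intro a ha i hi
        rcases Multiset.mem_cons.1 ha with rfl | h
        · simpa [hσ] using hsum i hi
        · obtain ⟨b, hb, rfl⟩ := Multiset.mem_map.1 h
          exact hc b hb i hi)
      (fun i hi => by simp [hσ])
    by_cases hmem : σ ∈ t
    · obtain ⟨t, rfl⟩ := Multiset.exists_cons_of_mem hmem
      obtain ⟨t, htc', rfl⟩ := Multiset.exists_le_map_eq f c t (by simpa using ht)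
      refine ⟨t, htc', fun i hi => ?_, ?_⟩
      · have := ht0 i hi
        simp only [Multiset.map_cons, Multiset.sum_cons, Multiset.map_map, hσ,
          Function.comp_def] at this
        linarith
      · simp at htc; omega
    · obtain ⟨t, htc', rfl⟩ :=
        Multiset.exists_le_map_eq f c t ((Multiset.le_cons_of_notMem hmem).1 ht)
      obtain ⟨r, rfl⟩ := Multiset.le_iff_exists_add.1 htc'
      have hr : ∀ i < n, (r.map fun a => f a i).sum = ((t + r).map fun a => f a i).sum := by
        intro i hi
        have := ht0 i hi
        simp only [Multiset.map_map, Function.comp_def] at this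
        simp [this]
      have := Multiset.card_pos.2 (show t ≠ 0 by simpa using htne)
      obtain ⟨t', h1, h2, h3⟩ := ih r.card (by rw [← hm, Multiset.card_add]; omega) r
        (fun a ha => hc a (by simp [ha])) (fun i hi => hr i hi ▸ hsum i hi) rfl
      exact ⟨t', h1.trans (by simp), fun i hi => (h2 i hi).trans (hr i hi), h3⟩

/-- `LabelledWalk E u l v`: the list `l` of pairs (source, label) describes a walk from `u` to `v`
along the labelled edges `E`. -/
inductive LabelledWalk {V L : Type*} (E : V → L → V → Prop) : V → List (V × L) → V → Prop
  | nil (v : V) : LabelledWalk E v [] v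
  | cons {u w v : V} {a : L} {l : List (V × L)} (h : E u a w) (hl : LabelledWalk E w l v) :
      LabelledWalk E u ((u, a) :: l) v

namespace LabelledWalk

variable {V L : Type*} {E : V → L → V → Prop}

theorem append {u v w : V} {l l' : List (V × L)} (h : LabelledWalk E u l v)
    (h' : LabelledWalk E v l' w) : LabelledWalk E u (l ++ l') w := by
  induction h with
  | nil => exact h'
  | cons e _ ih => exact cons e (ih h')

theorem exists_split {u v b : V} {l : List (V × L)} (h : LabelledWalk E u l v)
    (hb : b ∈ l.map Prod.fst ∨ b = v) :
    ∃ l₁ l₂, l = l₁ ++ l₂ ∧ LabelledWalk E u l₁ b ∧ LabelledWalk E b l₂ v := by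
  induction h with
  | nil v =>
    obtain rfl : b = v := by simpa using hb
    exact ⟨[], [], rfl, nil _, nil _⟩
  | @cons u w v a l e hl ih =>
    by_cases hbu : b = u
    · subst hbu
      exact ⟨[], _, rfl, nil _, cons e hl⟩
    · obtain ⟨l₁, l₂, rfl, h₁, h₂⟩ := ih (by simpa [hbu] using hb)
      exact ⟨_ :: l₁, l₂, rfl, cons e h₁, h₂⟩

theorem source_mem {S : Finset V} (hE : ∀ u a w, E u a w → u ∈ S) {u v : V} {l : List (V × L)}
    (h : LabelledWalk E u l v) : ∀ x ∈ l.map Prod.fst, x ∈ S := by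
  induction h with
  | nil => simp
  | cons e _ ih =>
    intro x hx
    rcases List.mem_cons.1 hx with rfl | hx
    · exact hE _ _ _ e
    · exact ih x hx

theorem exists_insert {u v : V} {l : List (V × L)} (h : LabelledWalk E u l v)
    (cs : List (List (V × L)))
    (hcs : ∀ c ∈ cs, ∃ b, (b ∈ l.map Prod.fst ∨ b = v) ∧ LabelledWalk E b c b) :
    ∃ l', LabelledWalk E u l' v ∧ l'.Perm (l ++ cs.flatten) := by
  induction cs with
  | nil => exact ⟨l, h, by simp⟩
  | cons c cs ih =>
    obtain ⟨l', hl', hp⟩ := ih fun c hc => hcs c (by simp [hc])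
    obtain ⟨b, hb, hbc⟩ := hcs c (by simp)
    have hb' : b ∈ l'.map Prod.fst ∨ b = v :=
      hb.imp_left fun hb => (hp.map Prod.fst).mem_iff.2 (by
        rw [List.map_append]; exact List.mem_append_left _ hb)
    obtain ⟨l₁, l₂, rfl, h₁, h₂⟩ := hl'.exists_split hb'
    refine ⟨l₁ ++ (c ++ l₂), h₁.append (hbc.append h₂), ?_⟩
    rw [List.flatten_cons]
    refine (List.perm_append_comm_assoc _ _ _).trans (((List.perm_append_left_iff c).2 hp).trans ?_)
    exact List.perm_append_comm_assoc _ _ _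

theorem exists_skeleton_aux [DecidableEq V] {S : Finset V} (hE : ∀ u a w, E u a w → u ∈ S)
    {u v : V} {l : List (V × L)} (h : LabelledWalk E u l v) :
    ∃ (z : V) (t s : List (V × L)) (cs : List (List (V × L))),
      LabelledWalk E u t z ∧ LabelledWalk E z s v ∧ (t.map Prod.fst).Nodup ∧
      (∀ x ∈ t.map Prod.fst, x ∈ s.map Prod.fst ∨ x = v) ∧
      s.length ≤ (S.card + 1) * (s.map Prod.fst).toFinset.card ∧
      (∀ c ∈ cs, c.length ≤ S.card + 1 ∧
        ∃ b, (b ∈ s.map Prod.fst ∨ b = v) ∧ LabelledWalk E b c b) ∧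
      l.Perm (t ++ s ++ cs.flatten) := by
  have hnodup : ∀ t : List (V × L), (t.map Prod.fst).Nodup → (∀ x ∈ t.map Prod.fst, x ∈ S) →
      t.length ≤ S.card := fun t ht htS => by
    rw [← List.length_map (f := Prod.fst), ← List.toFinset_card_of_nodup ht]
    exact Finset.card_le_card fun x hx => htS x (List.mem_toFinset.1 hx)
  induction h with
  | nil v => exact ⟨v, [], [], [], nil _, nil _, by simp, by simp, by simp, by simp, by simp⟩
  | @cons u w v a l e hl ih =>
    obtain ⟨z, t, s, cs, ht, hs, htn, hts, hsl, hcs, hp⟩ := ih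
    have htS := hnodup t htn (ht.source_mem hE)
    by_cases hu : u ∈ s.map Prod.fst ∨ u = v
    · by_cases hut : u ∈ t.map Prod.fst ∨ u = z
      · obtain ⟨t₁, t₂, rfl, h₁, h₂⟩ := ht.exists_split hut
        refine ⟨z, t₂, s, ((u, a) :: t₁) :: cs, h₂, hs, ?_, ?_, hsl, ?_, ?_⟩
        · rw [List.map_append] at htn
          exact htn.of_append_right
        · intro x hx
          exact hts x (by rw [List.map_append]; exact List.mem_append_right _ hx)
        · intro c hc
          rcases List.mem_cons.1 hc with rfl | hc
          · refine ⟨?_, u, hu, cons e h₁⟩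
            simp only [List.length_append, List.length_cons] at htS ⊢
            omega
          · exact hcs c hc
        · refine (List.Perm.cons (u, a) hp).trans ?_
          rw [List.flatten_cons, ← Multiset.coe_eq_coe]
          simp only [← Multiset.coe_add, ← Multiset.cons_coe, ← Multiset.singleton_add]
          abel
      · push Not at hut
        refine ⟨z, (u, a) :: t, s, cs, cons e ht, hs, ?_, ?_, hsl, hcs, List.Perm.cons (u, a) hp⟩
        · simpa using ⟨by simpa using hut.1, htn⟩
        · intro x hx
          rcases List.mem_cons.1 hx with rfl | hx
          · exact hu
          · exact hts x hx
    · push Not at hu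
      refine ⟨u, [], (u, a) :: (t ++ s), cs, nil _, cons e (ht.append hs), by simp, by simp, ?_, ?_,
        List.Perm.cons (u, a) hp⟩
      · have h1 : (insert u (s.map Prod.fst).toFinset).card ≤
            (((u, a) :: (t ++ s)).map Prod.fst).toFinset.card := by
          refine Finset.card_le_card fun x hx => ?_
          simp only [Finset.mem_insert, List.mem_toFinset, List.map_cons, List.map_append,
            List.mem_cons, List.mem_append] at hx ⊢
          tauto
        rw [Finset.card_insert_of_notMem (by simpa using hu.1)] at h1
        have h2 := Nat.mul_le_mul_left (S.card + 1) h1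
        simp only [List.length_append, List.length_cons]
        linarith
      · intro c hc
        obtain ⟨h1, b, h2, h3⟩ := hcs c hc
        refine ⟨h1, b, h2.imp_left fun h => ?_, h3⟩
        simp only [List.map_cons, List.map_append, List.mem_cons, List.mem_append]
        tauto

theorem exists_skeleton {S : Finset V} (hE : ∀ u a w, E u a w → u ∈ S)
    {u v : V} {l : List (V × L)} (h : LabelledWalk E u l v) :
    ∃ (s : List (V × L)) (cs : List (List (V × L))),
      LabelledWalk E u s v ∧ s.length ≤ (S.card + 1) ^ 2 ∧
      (∀ c ∈ cs, c.length ≤ S.card + 1 ∧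
        ∃ b, (b ∈ s.map Prod.fst ∨ b = v) ∧ LabelledWalk E b c b) ∧
      l.Perm (s ++ cs.flatten) := by
  classical
  obtain ⟨z, t, s, cs, ht, hs, htn, -, hsl, hcs, hp⟩ := exists_skeleton_aux hE h
  refine ⟨t ++ s, cs, ht.append hs, ?_, fun c hc => ?_, hp⟩
  · have h1 : t.length ≤ S.card := by
      rw [← List.length_map (f := Prod.fst), ← List.toFinset_card_of_nodup htn]
      exact Finset.card_le_card fun x hx => ht.source_mem hE x (List.mem_toFinset.1 hx)
    have h2 : (s.map Prod.fst).toFinset.card ≤ S.card :=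
      Finset.card_le_card fun x hx => hs.source_mem hE x (List.mem_toFinset.1 hx)
    have h3 := Nat.mul_le_mul_left (S.card + 1) h2
    rw [List.length_append]
    nlinarith
  · obtain ⟨h1, b, h2, h3⟩ := hcs c hc
    refine ⟨h1, b, h2.imp_left fun h => ?_, h3⟩
    rw [List.map_append]
    exact List.mem_append_right _ h

end LabelledWalk

/-- A bound for the length of a shortest walk of prescribed small weight in `ℤ ^ n`, in a graph with
at most `N` vertices. -/
def shortWalkBound (N n : ℕ) : ℕ :=
  (N + 1) ^ 2 + (2 * ((N + 1) ^ 2 + 1) + 1) ^ 3 ^ n * (N + 1)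

theorem List.abs_sum_map_le_length {α : Type*} (g : α → ℤ) (l : List α)
    (hg : ∀ a, |g a| ≤ 1) : |(l.map g).sum| ≤ l.length := by
  induction l with
  | nil => simp
  | cons a l ih =>
    have h1 := hg a
    have := abs_add_le (g a) (l.map g).sum
    simp only [List.map_cons, List.sum_cons, List.length_cons]
    push_cast
    linarith

theorem List.sum_map_flatten_eq {α : Type*} (g : α → ℤ) (B : List (List α)) :
    (B.flatten.map g).sum = (B.map fun b => (b.map g).sum).sum := by
  rw [List.map_flatten, List.sum_flatten, List.map_map]
  rfl

theorem LabelledWalk.exists_short {V L : Type*} {E : V → L → V → Prop} {S : Finset V} {N n : ℕ}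
    (hE : ∀ u a w, E u a w → u ∈ S) (hN : S.card ≤ N) (f : L → ℕ → ℤ) (hf : ∀ a i, |f a i| ≤ 1)
    {u v : V} {l : List (V × L)} (h : LabelledWalk E u l v)
    (hl : ∀ i < n, |(l.map fun e => f e.2 i).sum| ≤ 1) :
    ∃ l', LabelledWalk E u l' v ∧ l'.length ≤ shortWalkBound N n ∧
      ∀ i < n, (l'.map fun e => f e.2 i).sum = (l.map fun e => f e.2 i).sum := by
  obtain ⟨s, cs, hs, hsl, hcs, hp⟩ := h.exists_skeleton hE
  have hsN : s.length ≤ (N + 1) ^ 2 := hsl.trans (Nat.pow_le_pow_left (by omega) 2)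
  have hsum : ∀ i, (l.map fun e => f e.2 i).sum =
      (s.map fun e => f e.2 i).sum + (cs.map fun c => (c.map fun e => f e.2 i).sum).sum := by
    intro i
    rw [(hp.map _).sum_eq, List.map_append, List.sum_append, List.sum_map_flatten_eq]
  obtain ⟨t, ht, htsum, htc⟩ := exists_small_submultiset_sum_eq n
    (fun (c : List (V × L)) i => (c.map fun e => f e.2 i).sum) ((N + 1) ^ 2 + 1) cs
    (fun c hc i _ => by
      have h1 := List.abs_sum_map_le_length (fun e : V × L => f e.2 i) c fun e => hf e.2 i
      have h2 := (hcs c hc).1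
      have h3 : c.length ≤ (N + 1) ^ 2 + 1 := by nlinarith
      exact h1.trans (by exact_mod_cast h3))
    (fun i hi => by
      have h1 := List.abs_sum_map_le_length (fun e : V × L => f e.2 i) s fun e => hf e.2 i
      have h2 := hl i hi
      have h3 : (s.length : ℤ) ≤ (N + 1) ^ 2 := by exact_mod_cast hsN
      rw [hsum] at h2
      rw [Multiset.map_coe, Multiset.sum_coe]
      push_cast
      rw [abs_le] at *
      constructor <;> linarith)
  obtain ⟨ds, rfl⟩ := Quot.exists_rep t
  have hmem : ∀ c ∈ ds, c ∈ cs := fun c hc => Multiset.mem_of_le ht hc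
  obtain ⟨l', hl', hp'⟩ := hs.exists_insert ds fun c hc => (hcs c (hmem c hc)).2
  refine ⟨l', hl', ?_, fun i hi => ?_⟩
  · have h1 : ds.flatten.length ≤ ds.length * (N + 1) := by
      rw [List.length_flatten]
      refine (List.sum_le_card_nsmul _ (N + 1) fun x hx => ?_).trans (by simp)
      obtain ⟨c, hc, rfl⟩ := List.mem_map.1 hx
      exact ((hcs c (hmem c hc)).1).trans (by omega)
    have h2 : ds.length ≤ _ := htc
    rw [hp'.length_eq, List.length_append]
    exact Nat.add_le_add hsN (h1.trans (Nat.mul_le_mul_right _ h2))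
  · rw [(hp'.map _).sum_eq, List.map_append, List.sum_append, List.sum_map_flatten_eq, hsum]
    exact congrArg _ (htsum i hi)

/-- Reading a common word from two sides: the state is the pair of words still to be matched, and
the label says which tile index is appended to the left or to the right, if any. -/
inductive TileStep (x y : ℕ → List Bool) (n : ℕ) :
    List Bool × List Bool → Option (ℕ ⊕ ℕ) → List Bool × List Bool → Prop
  | left {i : ℕ} (hi : i < n) (b : List Bool) : TileStep x y n ([], b) (some (.inl i)) (x i, b)
  | right {j : ℕ} (hj : j < n) (a : List Bool) : TileStep x y n (a, []) (some (.inr j)) (a, y j)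
  | cancel (c : Bool) (a b : List Bool) : TileStep x y n (c :: a, c :: b) none (a, b)

/-- The index appended to the left by a step. -/
def leftIndex : Option (ℕ ⊕ ℕ) → List ℕ
  | some (.inl i) => [i]
  | _ => []

/-- The index appended to the right by a step. -/
def rightIndex : Option (ℕ ⊕ ℕ) → List ℕ
  | some (.inr j) => [j]
  | _ => []

@[simp] theorem leftIndex_none : leftIndex none = [] := rfl

@[simp] theorem leftIndex_inl (i : ℕ) : leftIndex (some (.inl i)) = [i] := rfl

@[simp] theorem leftIndex_inr (j : ℕ) : leftIndex (some (.inr j)) = [] := rfl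

@[simp] theorem rightIndex_none : rightIndex none = [] := rfl

@[simp] theorem rightIndex_inl (i : ℕ) : rightIndex (some (.inl i)) = [] := rfl

@[simp] theorem rightIndex_inr (j : ℕ) : rightIndex (some (.inr j)) = [j] := rfl

/-- The contribution of a step to the difference of the Parikh vectors. -/
def tileWeight (a : Option (ℕ ⊕ ℕ)) (k : ℕ) : ℤ :=
  (leftIndex a).count k - (rightIndex a).count k

theorem abs_tileWeight_le (a : Option (ℕ ⊕ ℕ)) (k : ℕ) : |tileWeight a k| ≤ 1 := by
  rcases a with _ | i | j
  · simp [tileWeight]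
  · simp only [tileWeight, leftIndex_inl, rightIndex_inl, List.count_singleton]
    split <;> simp
  · simp only [tileWeight, leftIndex_inr, rightIndex_inr, List.count_singleton]
    split <;> simp

theorem sum_tileWeight {V : Type*} (l : List (V × Option (ℕ ⊕ ℕ))) (k : ℕ) :
    (l.map fun e => tileWeight e.2 k).sum =
      ((l.flatMap fun e => leftIndex e.2).count k : ℤ) -
        (l.flatMap fun e => rightIndex e.2).count k := by
  induction l with
  | nil => simp
  | cons e l ih =>
    simp only [List.map_cons, List.sum_cons, List.flatMap_cons, List.count_append, ih]
    rw [tileWeight]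
    push_cast
    ring

theorem length_flatMap_leftIndex_le {V : Type*} (l : List (V × Option (ℕ ⊕ ℕ))) :
    (l.flatMap fun e => leftIndex e.2).length ≤ l.length := by
  induction l with
  | nil => simp
  | cons e l ih =>
    have : (leftIndex e.2).length ≤ 1 := by rcases e.2 with _ | i | j <;> simp
    simp only [List.flatMap_cons, List.length_append, List.length_cons]
    omega

theorem exists_walk_of_append_eq {x y : ℕ → List Bool} {n : ℕ}
    {S T : Finset (List Bool)}
    (hS : ∀ c a, c :: a ∈ S → a ∈ S) (hT : ∀ c b, c :: b ∈ T → b ∈ T)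
    (hx : ∀ i < n, x i ∈ S) (hy : ∀ j < n, y j ∈ T) (a b : List Bool) (I J : List ℕ)
    (ha : a ∈ S) (hb : b ∈ T) (hI : ∀ i ∈ I, i < n) (hJ : ∀ j ∈ J, j < n)
    (heq : a ++ (I.map x).flatten = b ++ (J.map y).flatten) :
    ∃ l, LabelledWalk (fun u e w => u ∈ S ×ˢ T ∧ TileStep x y n u e w) (a, b) l ([], []) ∧
      (l.flatMap fun e => leftIndex e.2) = I ∧ (l.flatMap fun e => rightIndex e.2) = J := by
  induction hm : a.length + b.length + I.length + J.length + (I.map x).flatten.length +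
    (J.map y).flatten.length using Nat.strong_induction_on generalizing a b I J with
  | _ m ih =>
    have hab : (a, b) ∈ S ×ˢ T := Finset.mem_product.2 ⟨ha, hb⟩
    match a, b, I, J with
    | [], b, i :: I, J =>
      obtain ⟨l, hl, h1, h2⟩ := ih _ (by
        rw [← hm]
        simp only [List.map_cons, List.flatten_cons, List.length_append, List.length_cons,
          List.length_nil]
        omega) (x i) b I J (hx i (hI i (by simp))) hb (fun k hk => hI k (by simp [hk])) hJ
          (by simpa using heq) rfl
      exact ⟨_, .cons ⟨hab, .left (hI i (by simp)) b⟩ hl, by simp [h1],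
        by simp [h2]⟩
    | a, [], I, j :: J =>
      obtain ⟨l, hl, h1, h2⟩ := ih _ (by
        rw [← hm]
        simp only [List.map_cons, List.flatten_cons, List.length_append, List.length_cons,
          List.length_nil]
        omega) a (y j) I J ha (hy j (hJ j (by simp))) hI (fun k hk => hJ k (by simp [hk]))
          (by simpa using heq) rfl
      exact ⟨_, .cons ⟨hab, .right (hJ j (by simp)) a⟩ hl, by simp [h1],
        by simp [h2]⟩
    | c :: a, d :: b, I, J =>
      simp only [List.cons_append, List.cons.injEq] at heq
      obtain ⟨rfl, heq⟩ := heq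
      obtain ⟨l, hl, h1, h2⟩ := ih _ (by
        rw [← hm]
        simp only [List.length_cons]
        omega) a b I J (hS _ _ ha) (hT _ _ hb) hI hJ heq rfl
      exact ⟨_, .cons ⟨hab, .cancel c a b⟩ hl, by simp [h1],
        by simp [h2]⟩
    | [], [], [], [] => exact ⟨[], .nil _, by simp, by simp⟩
    | [], d :: b, [], J => simp at heq
    | c :: a, [], I, [] => simp at heq

theorem append_eq_of_walk {x y : ℕ → List Bool} {n : ℕ} {S : Finset (List Bool × List Bool)}
    {u v : List Bool × List Bool} {l : List ((List Bool × List Bool) × Option (ℕ ⊕ ℕ))}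
    (h : LabelledWalk (fun u e w => u ∈ S ∧ TileStep x y n u e w) u l v) (hv : v = ([], [])) :
    (∀ i ∈ l.flatMap fun e => leftIndex e.2, i < n) ∧
      (∀ j ∈ l.flatMap fun e => rightIndex e.2, j < n) ∧
      u.1 ++ ((l.flatMap fun e => leftIndex e.2).map x).flatten =
        u.2 ++ ((l.flatMap fun e => rightIndex e.2).map y).flatten := by
  induction h with
  | nil v => simp [hv]
  | cons e _ ih =>
    obtain ⟨h1, h2, h3⟩ := ih hv
    cases e.2 with
    | left hi b =>
      simp only [List.flatMap_cons, leftIndex_inl, rightIndex_inl, List.singleton_append,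
        List.nil_append, List.forall_mem_cons, List.map_cons, List.flatten_cons]
      exact ⟨⟨hi, h1⟩, h2, h3⟩
    | right hj a =>
      simp only [List.flatMap_cons, leftIndex_inr, rightIndex_inr, List.singleton_append,
        List.nil_append, List.forall_mem_cons, List.map_cons, List.flatten_cons]
      exact ⟨h1, ⟨hj, h2⟩, h3⟩
    | cancel c a b =>
      simp only [List.flatMap_cons, leftIndex_none, rightIndex_none, List.nil_append,
        List.cons_append, List.cons.injEq, true_and]
      exact ⟨h1, h2, h3⟩

theorem exists_bounded_solution {x y : ℕ → List Bool} {n N : ℕ}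
    {S T : Finset (List Bool)} (hT0 : [] ∈ T)
    (hS : ∀ c a, c :: a ∈ S → a ∈ S) (hT : ∀ c b, c :: b ∈ T → b ∈ T)
    (hx : ∀ i < n, x i ∈ S) (hy : ∀ j < n, y j ∈ T) (hN : S.card * T.card ≤ N)
    {I J : List ℕ} (hI0 : I ≠ []) (hI : ∀ i ∈ I, i < n) (hJ : ∀ j ∈ J, j < n) (hIJ : I.Perm J)
    (heq : (I.map x).flatten = (J.map y).flatten) :
    ∃ I' J' : List ℕ, I' ≠ [] ∧ (∀ i ∈ I', i < n) ∧ (∀ j ∈ J', j < n) ∧ I'.Perm J' ∧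
      (I'.map x).flatten = (J'.map y).flatten ∧ I'.length ≤ shortWalkBound N n + 1 := by
  obtain ⟨i, I, rfl⟩ := List.exists_cons_of_ne_nil hI0
  have hi : i < n := hI i (by simp)
  obtain ⟨l, hl, h1, h2⟩ := exists_walk_of_append_eq hS hT hx hy (x i) [] I J (hx i hi) hT0
    (fun k hk => hI k (by simp [hk])) hJ (by simpa using heq)
  have hw : ∀ k, (l.map fun e => tileWeight e.2 k).sum = -([i].count k : ℤ) := by
    intro k
    have := hIJ.count_eq k
    rw [← List.singleton_append, List.count_append] at this
    rw [sum_tileWeight, h1, h2]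
    omega
  obtain ⟨l', hl', hlen, hsum⟩ := hl.exists_short (S := S ×ˢ T) (N := N) (n := n)
    (fun u a w h => h.1)
    (by rwa [Finset.card_product]) tileWeight abs_tileWeight_le (fun k _ => by
      rw [hw, List.count_singleton]
      split <;> simp)
  obtain ⟨g1, g2, g3⟩ := append_eq_of_walk hl' rfl
  have hI' : ∀ k ∈ i :: l'.flatMap fun e => leftIndex e.2, k < n := by
    intro k hk
    rcases List.mem_cons.1 hk with rfl | hk
    · exact hi
    · exact g1 k hk
  refine ⟨i :: l'.flatMap fun e => leftIndex e.2, l'.flatMap fun e => rightIndex e.2, by simp,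
    hI', g2, List.perm_iff_count.2 fun k => ?_, by simpa using g3, ?_⟩
  · by_cases hk : k < n
    · have := hsum k hk
      rw [hw, sum_tileWeight] at this
      rw [← List.singleton_append, List.count_append]
      omega
    · rw [List.count_eq_zero_of_not_mem fun h => hk (hI' k h),
        List.count_eq_zero_of_not_mem fun h => hk (g2 k h)]
  · have := length_flatMap_leftIndex_le l'
    rw [List.length_cons]
    omega

/-- All suffixes of the words in `X`, together with the empty word. -/
def suffixes (X : List (List Bool)) : Finset (List Bool) :=
  (X.flatMap List.tails ++ [[]]).toFinset

theorem mem_suffixes {X : List (List Bool)} {a : List Bool} :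
    a ∈ suffixes X ↔ (∃ w ∈ X, a <:+ w) ∨ a = [] := by
  simp [suffixes, or_comm]

theorem mem_suffixes_of_cons {X : List (List Bool)} (c : Bool) (a : List Bool)
    (h : c :: a ∈ suffixes X) : a ∈ suffixes X := by
  rw [mem_suffixes] at *
  obtain ⟨w, hw, hs⟩ := h.resolve_right (by simp)
  exact .inl ⟨w, hw, (List.suffix_cons c a).trans hs⟩

theorem getD_mem_suffixes (X : List (List Bool)) (i : ℕ) (hi : i < X.length) :
    X.getD i [] ∈ suffixes X := by
  rw [mem_suffixes, List.getD_eq_getElem _ _ hi]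
  exact .inl ⟨_, List.getElem_mem hi, List.suffix_rfl⟩

theorem card_suffixes_le (X : List (List Bool)) :
    (suffixes X).card ≤ X.flatten.length + X.length + 1 := by
  refine (List.toFinset_card_le _).trans ?_
  rw [List.length_append, List.length_singleton]
  refine Nat.add_le_add_right ?_ 1
  induction X with
  | nil => simp
  | cons a X ih =>
    simp only [List.flatMap_cons, List.length_append, List.length_tails, List.flatten_cons,
      List.length_cons]
    omega

/-- A bound for the length of a shortest solution of the permuted Post correspondence problem. -/
def solutionBound (p : List (List Bool) × List (List Bool)) : ℕ :=
  shortWalkBound ((p.1.flatten.length + p.1.length + 1) * (p.2.flatten.length + p.2.length + 1))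
    p.1.length + 1

/-- All lists of length at most `k` with entries smaller than `n`. -/
def boundedLists (n k : ℕ) : List (List ℕ) :=
  Nat.rec [[]] (fun _ L => [] :: L.flatMap fun l => (List.range n).map fun i => i :: l) k

theorem mem_boundedLists {n k : ℕ} {l : List ℕ} :
    l ∈ boundedLists n k ↔ l.length ≤ k ∧ ∀ i ∈ l, i < n := by
  induction k generalizing l with
  | zero => simp +contextual [boundedLists]
  | succ k ih =>
    change l ∈ [] :: (boundedLists n k).flatMap _ ↔ _
    cases l with
    | nil => simp
    | cons a l => simp [ih, and_left_comm]

theorem Primrec.nat_pow : Primrec₂ ((· ^ ·) : ℕ → ℕ → ℕ) :=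
  (Primrec.nat_rec (f := fun _ : ℕ => 1) (g := fun a q => q.2 * a) (Primrec.const 1)
    (Primrec.nat_mul.comp (Primrec.snd.comp Primrec.snd) Primrec.fst)).of_eq fun a b => by
      induction b with
      | zero => rfl
      | succ b ih => rw [pow_succ, ← ih]

theorem primrec_solutionBound : Primrec solutionBound := by
  have size : Primrec fun X : List (List Bool) => X.flatten.length + X.length + 1 :=
    Primrec.succ.comp (Primrec.nat_add.comp (Primrec.list_length.comp Primrec.list_flatten)
      Primrec.list_length)
  have sw : Primrec₂ shortWalkBound := by
    have hN : Primrec fun p : ℕ × ℕ => p.1 + 1 := Primrec.succ.comp Primrec.fst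
    have hsq := Primrec.nat_pow.comp hN (Primrec.const 2)
    exact Primrec.nat_add.comp hsq (Primrec.nat_mul.comp (Primrec.nat_pow.comp
      (Primrec.succ.comp (Primrec.nat_mul.comp (Primrec.const 2) (Primrec.succ.comp hsq)))
      (Primrec.nat_pow.comp (Primrec.const 3) Primrec.snd)) hN)
  exact Primrec.succ.comp (sw.comp (Primrec.nat_mul.comp (size.comp Primrec.fst)
    (size.comp Primrec.snd)) (Primrec.list_length.comp Primrec.fst))

theorem primrec_boundedLists : Primrec₂ boundedLists := by
  refine Primrec.nat_rec (f := fun _ : ℕ => [[]])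
    (g := fun n q => [] :: q.2.flatMap fun l => (List.range n).map fun i => i :: l)
    (Primrec.const _) ?_
  refine Primrec.list_cons.comp (Primrec.const []) (Primrec.list_flatMap
    (Primrec.snd.comp Primrec.snd) ?_)
  exact Primrec.list_map (Primrec.list_range.comp (Primrec.fst.comp Primrec.fst))
    (Primrec.list_cons.comp Primrec.snd (Primrec.snd.comp Primrec.fst))

theorem primrecRel_perm : PrimrecRel (List.Perm : List ℕ → List ℕ → Prop) := by
  have hc : Primrec₂ fun (l : List ℕ) (k : ℕ) => (l.filter fun i => i = k).length :=
    Primrec.list_length.comp (PrimrecRel.listFilter (R := fun i k : ℕ => i = k) Primrec.eq)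
  have hR : PrimrecRel fun (k : ℕ) (q : List ℕ × List ℕ) =>
      (q.1.filter fun i => i = k).length = (q.2.filter fun i => i = k).length :=
    Primrec.eq.comp (hc.comp (Primrec.fst.comp Primrec.snd) Primrec.fst)
      (hc.comp (Primrec.snd.comp Primrec.snd) Primrec.fst)
  refine (hR.forall_mem_list.comp (Primrec.list_append.comp Primrec.fst Primrec.snd)
    Primrec.id).of_eq fun q => ?_
  have hcount : ∀ (l : List ℕ) k, (l.filter fun i => i = k).length = l.count k := by
    intro l k
    rw [List.count, List.countP_eq_length_filter]
    rfl
  simp only [hcount, List.mem_append, id]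
  rw [List.perm_iff_count]
  refine ⟨fun h k => ?_, fun h k _ => h k⟩
  by_cases hk : k ∈ q.1 ∨ k ∈ q.2
  · exact h k hk
  · push Not at hk
    rw [List.count_eq_zero_of_not_mem hk.1, List.count_eq_zero_of_not_mem hk.2]

theorem primrec_concat : Primrec₂ fun (X : List (List Bool)) (I : List ℕ) =>
    (I.map fun i => X.getD i []).flatten :=
  Primrec.list_flatten.comp (Primrec.list_map Primrec.snd
    ((Primrec.list_getD []).comp (Primrec.fst.comp Primrec.fst) Primrec.snd))

theorem primrecPred_bounded_solution :
    PrimrecPred fun p : List (List Bool) × List (List Bool) =>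
      ∃ I ∈ boundedLists p.1.length (solutionBound p),
        ∃ J ∈ boundedLists p.1.length (solutionBound p), I ≠ [] ∧ I.Perm J ∧
          (I.map fun i => p.1.getD i []).flatten = (J.map fun j => p.2.getD j []).flatten := by
  have hL : Primrec fun p : List (List Bool) × List (List Bool) =>
      boundedLists p.1.length (solutionBound p) :=
    primrec_boundedLists.comp (Primrec.list_length.comp Primrec.fst) primrec_solutionBound
  have hR : PrimrecRel fun (J : List ℕ) (q : List ℕ × List (List Bool) × List (List Bool)) =>
      q.1 ≠ [] ∧ q.1.Perm J ∧
        (q.1.map fun i => q.2.1.getD i []).flatten =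
          (J.map fun j => q.2.2.getD j []).flatten := by
    have hI := Primrec.fst.comp (Primrec.snd (α := List ℕ)
      (β := List ℕ × List (List Bool) × List (List Bool)))
    have hp := Primrec.snd.comp (Primrec.snd (α := List ℕ)
      (β := List ℕ × List (List Bool) × List (List Bool)))
    exact (Primrec.eq.comp hI (Primrec.const [])).not.and
      ((primrecRel_perm.comp hI Primrec.fst).and
        (Primrec.eq.comp (primrec_concat.comp (Primrec.fst.comp hp) hI)
          (primrec_concat.comp (Primrec.snd.comp hp) Primrec.fst)))
  have hR' : PrimrecRel fun (I : List ℕ) (p : List (List Bool) × List (List Bool)) =>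
      ∃ J ∈ boundedLists p.1.length (solutionBound p), I ≠ [] ∧ I.Perm J ∧
        (I.map fun i => p.1.getD i []).flatten = (J.map fun j => p.2.getD j []).flatten :=
    hR.exists_mem_list.comp (hL.comp Primrec.snd) Primrec.id
  exact hR'.exists_mem_list.comp hL Primrec.id

theorem exists_solution_iff_bounded (p : List (List Bool) × List (List Bool))
    (hlen : p.1.length = p.2.length) :
    (∃ I J : List ℕ, I ≠ [] ∧ (∀ i ∈ I, i < p.1.length) ∧ (∀ j ∈ J, j < p.2.length) ∧ I.Perm J ∧
        (I.map fun i => p.1.getD i []).flatten = (J.map fun j => p.2.getD j []).flatten) ↔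
      ∃ I ∈ boundedLists p.1.length (solutionBound p),
        ∃ J ∈ boundedLists p.1.length (solutionBound p), I ≠ [] ∧ I.Perm J ∧
          (I.map fun i => p.1.getD i []).flatten = (J.map fun j => p.2.getD j []).flatten := by
  constructor
  · rintro ⟨I, J, h0, hI, hJ, hIJ, heq⟩
    obtain ⟨I', J', h0', hI', hJ', hIJ', heq', hb⟩ := exists_bounded_solution
      (mem_suffixes.2 (.inr rfl)) mem_suffixes_of_cons
      mem_suffixes_of_cons (getD_mem_suffixes p.1)
      (fun j hj => getD_mem_suffixes p.2 j (hlen ▸ hj))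
      (Nat.mul_le_mul (card_suffixes_le p.1) (card_suffixes_le p.2)) h0 hI (hlen ▸ hJ) hIJ heq
    exact ⟨I', mem_boundedLists.2 ⟨hb, hI'⟩, J',
      mem_boundedLists.2 ⟨hIJ'.length_eq ▸ hb, hJ'⟩, h0', hIJ', heq'⟩
  · rintro ⟨I, hI, J, hJ, h0, hIJ, heq⟩
    exact ⟨I, J, h0, (mem_boundedLists.1 hI).2, hlen ▸ (mem_boundedLists.1 hJ).2, hIJ, heq⟩

/-- the Permuted Post Correspondence Problem is decidable.
An instance is a pair `(X, Y)` of equal-length lists of nonempty words over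
`{0,1}` (encoded as `List Bool`); it is a yes-instance iff there exist a
nonempty list of indices `I` and a list of indices `J` (all indices valid,
i.e. `< n`), such that `I` is a rearrangement of `J` and the concatenations
`x_{i₁}⋯x_{i_k}` and `y_{j₁}⋯y_{j_k}` coincide.  This predicate on
(encodable) pairs of lists of words is computable. -/
theorem stmt_15 :
    ComputablePred (fun p : List (List Bool) × List (List Bool) =>
      p.1.length = p.2.length ∧ (∀ x ∈ p.1, x ≠ []) ∧ (∀ y ∈ p.2, y ≠ []) ∧
      ∃ I J : List ℕ, I ≠ [] ∧ (∀ i ∈ I, i < p.1.length) ∧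
        (∀ j ∈ J, j < p.2.length) ∧ I.Perm J ∧
        (I.map fun i => p.1.getD i []).flatten =
          (J.map fun j => p.2.getD j []).flatten) := by
  have hne : PrimrecPred fun X : List (List Bool) => ∀ x ∈ X, x ≠ [] :=
    (Primrec.eq.comp Primrec.id (Primrec.const [])).not.forall_mem_list
  refine PrimrecPred.computablePred ?_
  refine ((Primrec.eq.comp (Primrec.list_length.comp Primrec.fst)
    (Primrec.list_length.comp Primrec.snd)).and ((hne.comp Primrec.fst).and
      ((hne.comp Primrec.snd).and primrecPred_bounded_solution))).of_eq fun p => ?_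
  refine and_congr_right fun hlen => and_congr_right fun _ => and_congr_right fun _ => ?_
  exact (exists_solution_iff_bounded p hlen).symm
end
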